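/- For every ε ∈ (0, 1/100) there exists a constant K = K(ε) > 0 such that for all H ≥ 1 and all z ≥ H^{1+ε}, one has | 2H² ∑_{d₁, d₂: d₁² ≤ z, d₂² ≤ z} (μ(d₁) μ(d₂) / (d₁² d₂²)) ∑_{λ ≥ 1} S( H λ / gcd(d₁², d₂²) )² − C · H^{1/2} | ≤ K · H^{1/2 − ε/8}. -/

import Mathlib

open MeasureTheory

/-- The constant `C = ζ(3/2)/π · ∏_p (1 - 3/p² + 2/p³)`. -/
noncomputable def sqfConst : ℝ :=
  ((riemannZeta (3 / 2)).re / Real.pi) *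
    ∏' p : Nat.Primes, (1 - 3 / ((p : ℕ) : ℝ) ^ 2 + 2 / ((p : ℕ) : ℝ) ^ 3)

/-- The sinc function `S(x) = sin(πx)/(πx)`, with `S(0) = 1`. -/
noncomputable def sinc (x : ℝ) : ℝ :=
  if x = 0 then 1 else Real.sin (Real.pi * x) / (Real.pi * x)

/-- The periodic function `{x}(1 - {x})`. -/
noncomputable def fractBump (x : ℝ) : ℝ := Int.fract x * (1 - Int.fract x)

lemma fractBump_nonneg (x : ℝ) : 0 ≤ fractBump x :=
  mul_nonneg (Int.fract_nonneg x) (sub_nonneg.2 (Int.fract_lt_one x).le)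

lemma fractBump_le_one (x : ℝ) : fractBump x ≤ 1 := by
  have h0 := Int.fract_nonneg x
  have h1 := Int.fract_lt_one x
  unfold fractBump
  nlinarith

lemma fractBump_zero : fractBump 0 = 0 := by simp [fractBump]

lemma fractBump_sub_le (x y : ℝ) : fractBump y - fractBump x ≤ |y - x| := by
  have hx0 := fractBump_nonneg x
  have hy0 := Int.fract_nonneg y
  have hy1 := Int.fract_lt_one y
  have hy : Int.fract y = y - ⌊y⌋ := rfl
  have hle := neg_abs_le (y - x)
  have hge := le_abs_self (y - x)
  rcases lt_or_ge x (⌊y⌋ : ℝ) with h | h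
  · have : fractBump y ≤ Int.fract y := by unfold fractBump; nlinarith
    linarith
  rcases le_or_gt ((⌊y⌋ : ℝ) + 1) x with h' | h'
  · have : fractBump y ≤ 1 - Int.fract y := by unfold fractBump; nlinarith
    linarith
  · have hfl : ⌊x⌋ = ⌊y⌋ := Int.floor_eq_iff.2 ⟨h, h'⟩
    have hx : Int.fract x = x - ⌊y⌋ := by rw [← hfl]; rfl
    have e : fractBump y - fractBump x = (y - x) * (1 - Int.fract y - Int.fract x) := by
      unfold fractBump
      rw [hx, hy]
      ring
    rw [e]
    refine (le_abs_self _).trans ?_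
    rw [abs_mul]
    refine mul_le_of_le_one_right (abs_nonneg _) (abs_le.2 ⟨?_, ?_⟩) <;> linarith

lemma abs_fractBump_sub_le (x y : ℝ) : |fractBump x - fractBump y| ≤ |x - y| := by
  refine abs_le.2 ⟨?_, fractBump_sub_le y x⟩
  have := fractBump_sub_le x y
  rw [abs_sub_comm] at this
  linarith

lemma continuous_fractBump : Continuous fractBump :=
  (LipschitzWith.of_dist_le_mul (K := 1) fun x y => by
    simpa [Real.dist_eq] using abs_fractBump_sub_le x y).continuous

lemma fractBump_le_rpow {x t : ℝ} (hx : 0 ≤ x) (ht0 : 0 ≤ t) (ht1 : t ≤ 1) :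
    fractBump x ≤ x ^ t := by
  rcases eq_or_lt_of_le hx with rfl | hx'
  · rw [fractBump_zero]
    positivity
  rcases le_total x 1 with h | h
  · calc fractBump x ≤ |x - 0| := by
          simpa [fractBump_zero] using fractBump_sub_le 0 x
      _ = x ^ (1 : ℝ) := by rw [sub_zero, abs_of_nonneg hx, Real.rpow_one]
      _ ≤ x ^ t := Real.rpow_le_rpow_of_exponent_ge hx' h ht1
  · exact (fractBump_le_one x).trans (Real.one_le_rpow h ht0)

lemma HasSum.congr_of_eq {ι : Type*} {f g : ι → ℝ} {a b : ℝ} (h : HasSum f a) (hfg : g = f)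
    (hab : b = a) : HasSum g b := by
  rwa [hfg, hab]

lemma hasSum_sin_sq_div_sq (x : ℝ) :
    HasSum (fun k : ℕ => Real.sin (Real.pi * k * x) ^ 2 / (k : ℝ) ^ 2)
      (Real.pi ^ 2 / 2 * fractBump x) := by
  have hf : Int.fract x ∈ Set.Icc (0 : ℝ) 1 := ⟨Int.fract_nonneg x, (Int.fract_lt_one x).le⟩
  have h1 := hasSum_one_div_nat_pow_mul_cos one_ne_zero hf
  have h0 := hasSum_one_div_nat_pow_mul_cos one_ne_zero
    (Set.left_mem_Icc.2 (zero_le_one (α := ℝ)))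
  have hd := (h0.sub h1).div_const 2
  have hval : ∀ y : ℝ, (Polynomial.map (algebraMap ℚ ℝ) (Polynomial.bernoulli 2)).eval y
      = y ^ 2 - y + 1 / 6 := fun y => by
    simp [Polynomial.bernoulli, Finset.sum_range_succ, bernoulli_one, bernoulli_two]
    ring
  simp only [mul_one, hval] at hd
  refine HasSum.congr_of_eq hd (funext fun k => ?_) ?_
  · have : Real.cos (2 * Real.pi * k * Int.fract x) = Real.cos (2 * (Real.pi * k * x)) := by
      have e : 2 * Real.pi * k * Int.fract x
          = 2 * (Real.pi * k * x) - ((k * ⌊x⌋ : ℤ) : ℝ) * (2 * Real.pi) := by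
        rw [show Int.fract x = x - ⌊x⌋ from rfl]
        push_cast
        ring
      rw [e, Real.cos_sub_int_mul_two_pi]
    rw [this, Real.cos_two_mul, Real.cos_sq', mul_zero, Real.cos_zero]
    ring
  · simp only [fractBump, Nat.factorial]
    norm_num
    ring

section
open Complex

lemma hasDerivAt_one_sub_cexp_div (b : ℂ) {x : ℝ} (hx : x ≠ 0) :
    HasDerivAt (fun x : ℝ => -(1 - cexp (-b * (x : ℂ) ^ 2)) / (x : ℂ))
      ((1 - cexp (-b * (x : ℂ) ^ 2)) / (x : ℂ) ^ 2 - 2 * b * cexp (-b * (x : ℂ) ^ 2)) x := by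
  have hx' : (x : ℂ) ≠ 0 := by exact_mod_cast hx
  have h : HasDerivAt (fun z : ℂ => -(1 - cexp (-b * z ^ 2)) / z)
      ((1 - cexp (-b * (x : ℂ) ^ 2)) / (x : ℂ) ^ 2 - 2 * b * cexp (-b * (x : ℂ) ^ 2)) (x : ℂ) := by
    have h1 : HasDerivAt (fun z : ℂ => -b * z ^ 2) (-b * (2 * x)) (x : ℂ) := by
      simpa using (hasDerivAt_pow 2 (x : ℂ)).const_mul (-b)
    refine (((h1.cexp.const_sub 1).neg).div (hasDerivAt_id' (x : ℂ)) hx').congr_deriv ?_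
    rw [Pi.neg_apply]
    field_simp
    ring
  exact h.comp_ofReal

lemma one_sub_exp_mul_cos_div_sq_le {d x : ℝ} (hd0 : 0 ≤ d) (hd1 : d ≤ 1) (hx : 0 < x) :
    |(1 - Real.exp (-d * x ^ 2) * Real.cos (x ^ 2)) / x ^ 2| ≤ 4 * (1 + x ^ 2)⁻¹ := by
  have he1 : Real.exp (-d * x ^ 2) ≤ 1 := Real.exp_le_one_iff.2 (by nlinarith [sq_nonneg x])
  have he0 := Real.exp_pos (-d * x ^ 2)
  have he2 := Real.add_one_le_exp (-d * x ^ 2)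
  have hc0 := Real.neg_one_le_cos (x ^ 2)
  have hc1 := Real.cos_le_one (x ^ 2)
  have hc2 := Real.one_sub_sq_div_two_le_cos (x := x ^ 2)
  have hx2 : 0 < x ^ 2 := by positivity
  have hnn : 0 ≤ 1 - Real.exp (-d * x ^ 2) * Real.cos (x ^ 2) := by nlinarith
  rw [abs_div, abs_of_nonneg hnn, abs_of_pos hx2, ← div_eq_mul_inv, div_le_div_iff₀ hx2 (by positivity)]
  rcases le_total (x ^ 2) 1 with h | h
  · have : 1 - Real.exp (-d * x ^ 2) * Real.cos (x ^ 2) ≤ 2 * x ^ 2 := by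
      have h3 : 1 - Real.exp (-d * x ^ 2) ≤ x ^ 2 := by nlinarith
      have h4 : Real.exp (-d * x ^ 2) * (1 - Real.cos (x ^ 2)) ≤ x ^ 2 := by
        nlinarith
      nlinarith
    nlinarith
  · have : 1 - Real.exp (-d * x ^ 2) * Real.cos (x ^ 2) ≤ 2 := by nlinarith
    nlinarith

lemma integrable_one_sub_exp_mul_cos_div_sq {d : ℝ} (hd0 : 0 ≤ d) (hd1 : d ≤ 1) :
    IntegrableOn (fun x : ℝ => (1 - Real.exp (-d * x ^ 2) * Real.cos (x ^ 2)) / x ^ 2)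
      (Set.Ioi 0) := by
  refine Integrable.mono' ((integrable_inv_one_add_sq.const_mul 4).integrableOn)
    (Measurable.aestronglyMeasurable (by fun_prop)) ?_
  filter_upwards [ae_restrict_mem measurableSet_Ioi] with x hx
  exact one_sub_exp_mul_cos_div_sq_le hd0 hd1 hx


lemma norm_cexp_neg_mul_sq_le {b : ℂ} (hb : 0 ≤ b.re) (x : ℝ) :
    ‖cexp (-b * (x : ℂ) ^ 2)‖ ≤ 1 := by
  rw [Complex.norm_exp]
  refine Real.exp_le_one_iff.2 ?_
  have : (-b * (x : ℂ) ^ 2).re = -(b.re * x ^ 2) := by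
    rw [← Complex.ofReal_pow, Complex.re_mul_ofReal, Complex.neg_re, neg_mul]
  rw [this]
  nlinarith [sq_nonneg x, mul_nonneg hb (sq_nonneg x)]

lemma integral_one_sub_cexp_div_sq {b : ℂ} (hb : 0 < b.re)
    (h_int : IntegrableOn (fun x : ℝ => (1 - cexp (-b * (x : ℂ) ^ 2)) / (x : ℂ) ^ 2) (Set.Ioi 0)) :
    ∫ x : ℝ in Set.Ioi 0, (1 - cexp (-b * (x : ℂ) ^ 2)) / (x : ℂ) ^ 2
      = b * (Real.pi / b) ^ (1 / 2 : ℂ) := by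
  have hg := ((integrable_cexp_neg_mul_sq hb).const_mul (2 * b)).integrableOn (s := Set.Ioi 0)
  have key := integral_Ioi_of_hasDerivAt_of_tendsto (a := 0) (m := 0)
    (f := fun x : ℝ => -(1 - cexp (-b * (x : ℂ) ^ 2)) / (x : ℂ))
    (f' := fun x : ℝ => (1 - cexp (-b * (x : ℂ) ^ 2)) / (x : ℂ) ^ 2
      - 2 * b * cexp (-b * (x : ℂ) ^ 2)) ?_
    (fun x hx => hasDerivAt_one_sub_cexp_div b (ne_of_gt hx)) (h_int.sub hg) ?_
  · rw [integral_sub h_int hg, integral_const_mul, integral_gaussian_complex_Ioi hb] at key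
    simp only [ofReal_zero, div_zero, sub_zero] at key
    rw [sub_eq_zero.1 key]
    ring
  · refine ContinuousAt.continuousWithinAt ?_
    have h : HasDerivAt (fun z : ℂ => -(1 - cexp (-b * z ^ 2))) 0 ((0 : ℝ) : ℂ) := by
      have h1 : HasDerivAt (fun z : ℂ => -b * z ^ 2) (-b * (2 * ((0 : ℝ) : ℂ))) ((0 : ℝ) : ℂ) := by
        simpa using (hasDerivAt_pow 2 ((0 : ℝ) : ℂ)).const_mul (-b)
      refine ((h1.cexp.const_sub 1).neg).congr_deriv ?_
      simp
    have h2 := h.comp_ofReal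
    rw [hasDerivAt_iff_tendsto_slope] at h2
    rw [continuousAt_iff_punctured_nhds]
    simp only [ofReal_zero, div_zero]
    refine h2.congr fun x => ?_
    simp [slope, div_eq_inv_mul]
  · refine squeeze_zero_norm' (a := fun x : ℝ => 2 / x) ?_
      (tendsto_const_nhds.div_atTop Filter.tendsto_id)
    filter_upwards [Filter.eventually_gt_atTop 0] with x hx
    rw [norm_div, norm_neg, Complex.norm_real, Real.norm_of_nonneg hx.le]
    gcongr
    refine (norm_sub_le _ _).trans ?_
    have := norm_cexp_neg_mul_sq_le hb.le x
    rw [norm_one]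
    linarith

lemma one_sub_cexp_div_sq_re (d x : ℝ) :
    ((1 - cexp (-(d + I) * (x : ℂ) ^ 2)) / (x : ℂ) ^ 2).re
      = (1 - Real.exp (-d * x ^ 2) * Real.cos (x ^ 2)) / x ^ 2 := by
  rw [← Complex.ofReal_pow, Complex.div_ofReal_re, Complex.sub_re, Complex.one_re, Complex.exp_re]
  simp [-Complex.ofReal_pow]

lemma integrable_one_sub_cexp_div_sq {b : ℂ} (hb : 0 ≤ b.re) :
    IntegrableOn (fun x : ℝ => (1 - cexp (-b * (x : ℂ) ^ 2)) / (x : ℂ) ^ 2) (Set.Ioi 0) := by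
  refine Integrable.mono' (g := fun x => (4 + 4 * ‖b‖) * (1 + x ^ 2)⁻¹)
    ((integrable_inv_one_add_sq.const_mul _).integrableOn)
    (Measurable.aestronglyMeasurable (by fun_prop)) ?_
  filter_upwards [ae_restrict_mem measurableSet_Ioi] with x hx
  have hx : 0 < x := hx
  have hx2 : 0 < x ^ 2 := by positivity
  have hb0 := norm_nonneg b
  have h1 : ‖1 - cexp (-b * (x : ℂ) ^ 2)‖ ≤ 2 := by
    refine (norm_sub_le _ _).trans ?_
    have := norm_cexp_neg_mul_sq_le hb x
    rw [norm_one]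
    linarith
  rw [norm_div, norm_pow, Complex.norm_real, Real.norm_of_nonneg hx.le, ← div_eq_mul_inv,
    div_le_div_iff₀ hx2 (by positivity)]
  have hn : ‖-b * (x : ℂ) ^ 2‖ = ‖b‖ * x ^ 2 := by
    rw [norm_mul, norm_neg, norm_pow, Complex.norm_real, Real.norm_of_nonneg hx.le]
  have h2 : ‖1 - cexp (-b * (x : ℂ) ^ 2)‖ ≤ 2 * (‖b‖ * x ^ 2) := by
    rcases le_total (‖b‖ * x ^ 2) 1 with h | h
    · rw [norm_sub_rev, ← hn]
      exact Complex.norm_exp_sub_one_le (hn.trans_le h)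
    · linarith
  nlinarith [mul_nonneg hb0 hx2.le]

lemma integral_one_sub_cos_sq_div_sq :
    ∫ x : ℝ in Set.Ioi 0, (1 - Real.cos (x ^ 2)) / x ^ 2 = √(Real.pi / 2) := by
  have hval : ∀ d : ℝ, 0 < d → d ≤ 1 →
      ∫ x : ℝ in Set.Ioi 0, (1 - Real.exp (-d * x ^ 2) * Real.cos (x ^ 2)) / x ^ 2
        = ((d + I) * (Real.pi / (d + I)) ^ (1 / 2 : ℂ)).re := by
    intro d hd _
    have hb : 0 < ((d : ℂ) + I).re := by simpa
    have h_int := integrable_one_sub_cexp_div_sq hb.le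
    rw [← integral_one_sub_cexp_div_sq hb h_int]
    have := integral_re (𝕜 := ℂ) h_int
    refine Eq.trans ?_ this
    exact integral_congr_ae (Filter.Eventually.of_forall fun x => (one_sub_cexp_div_sq_re d x).symm)
  have hlim1 : Filter.Tendsto (fun d : ℝ => ((d + I) * (Real.pi / (d + I)) ^ (1 / 2 : ℂ)).re)
      (nhdsWithin 0 (Set.Ioi 0)) (nhds (((0 : ℝ) + I) * (Real.pi / ((0 : ℝ) + I)) ^ (1 / 2 : ℂ)).re) := by
    refine (ContinuousAt.tendsto ?_).mono_left nhdsWithin_le_nhds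
    have hne : ((0 : ℝ) : ℂ) + I ≠ 0 := by simp
    have hsl : (Real.pi : ℂ) / (((0 : ℝ) : ℂ) + I) ∈ slitPlane := by
      right
      simp [Real.pi_ne_zero]
    have h1 : ContinuousAt (fun d : ℝ => (d : ℂ) + I) 0 := by fun_prop
    exact Complex.continuous_re.continuousAt.comp
      (h1.mul ((continuousAt_const.div h1 hne).cpow continuousAt_const hsl))
  have hlim2 : Filter.Tendsto (fun d : ℝ =>
      ∫ x : ℝ in Set.Ioi 0, (1 - Real.exp (-d * x ^ 2) * Real.cos (x ^ 2)) / x ^ 2)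
      (nhdsWithin 0 (Set.Ioi 0))
      (nhds (∫ x : ℝ in Set.Ioi 0, (1 - Real.cos (x ^ 2)) / x ^ 2)) := by
    refine tendsto_integral_filter_of_dominated_convergence (fun x => 4 * (1 + x ^ 2)⁻¹)
      (Filter.Eventually.of_forall fun d => Measurable.aestronglyMeasurable (by fun_prop)) ?_
      ((integrable_inv_one_add_sq.const_mul 4).integrableOn)
      (Filter.Eventually.of_forall fun x => ?_)
    · filter_upwards [Ioc_mem_nhdsGT (zero_lt_one (α := ℝ))] with d hd
      filter_upwards [ae_restrict_mem measurableSet_Ioi] with x hx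
      exact one_sub_exp_mul_cos_div_sq_le hd.1.le hd.2 hx
    · refine Filter.Tendsto.mono_left ?_ nhdsWithin_le_nhds
      have : ContinuousAt (fun d : ℝ =>
        (1 - Real.exp (-d * x ^ 2) * Real.cos (x ^ 2)) / x ^ 2) 0 := by fun_prop
      simpa using this.tendsto
  have heq := tendsto_nhds_unique (hlim2.congr' (by
    filter_upwards [Ioc_mem_nhdsGT (zero_lt_one (α := ℝ))] with d hd using hval d hd.1 hd.2)) hlim1
  rw [heq, Complex.ofReal_zero, zero_add]
  have hsq : (Real.pi : ℂ) / I = (((√(Real.pi / 2) : ℝ) : ℂ) * (1 - I)) ^ 2 := by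
    have h2 : (((√(Real.pi / 2) : ℝ) : ℂ)) ^ 2 = Real.pi / 2 := by
      rw [← Complex.ofReal_pow, Real.sq_sqrt (by positivity)]
      push_cast
      rfl
    rw [mul_pow, h2, Complex.div_I]
    linear_combination (-(Real.pi : ℂ) / 2) * Complex.I_sq
  have hre : 0 < (((√(Real.pi / 2) : ℝ) : ℂ) * (1 - I)).re := by
    rw [Complex.re_ofReal_mul]
    simp [Real.pi_pos]
  rw [hsq, one_div, Complex.sq_cpow_two_inv hre]
  simp

end

lemma sin_sq_mul_sq_div_sq_eq {c : ℝ} (hc : 0 < c) (x : ℝ) :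
    Real.sin (c * x ^ 2) ^ 2 / x ^ 2
      = c * ((1 - Real.cos ((√(2 * c) * x) ^ 2)) / (√(2 * c) * x) ^ 2) := by
  rw [mul_pow, Real.sq_sqrt (by positivity), mul_assoc 2 c, Real.cos_two_mul, Real.cos_sq']
  rcases eq_or_ne x 0 with rfl | hx
  · simp
  · field_simp
    ring

lemma integrable_sin_sq_mul_sq_div_sq {c : ℝ} (hc : 0 < c) :
    IntegrableOn (fun x : ℝ => Real.sin (c * x ^ 2) ^ 2 / x ^ 2) (Set.Ioi 0) := by
  simp only [sin_sq_mul_sq_div_sq_eq hc]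
  refine Integrable.const_mul ?_ c
  have h0 : IntegrableOn (fun x : ℝ => (1 - Real.cos (x ^ 2)) / x ^ 2)
      (Set.Ioi (√(2 * c) * 0)) := by
    simpa using integrable_one_sub_exp_mul_cos_div_sq le_rfl zero_le_one
  exact (integrableOn_Ioi_comp_mul_left_iff (fun x : ℝ => (1 - Real.cos (x ^ 2)) / x ^ 2) 0
    (by positivity : 0 < √(2 * c))).2 h0

lemma integral_sin_sq_mul_sq_div_sq {c : ℝ} (hc : 0 < c) :
    ∫ x : ℝ in Set.Ioi 0, Real.sin (c * x ^ 2) ^ 2 / x ^ 2 = √(Real.pi * c) / 2 := by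
  simp only [sin_sq_mul_sq_div_sq_eq hc]
  rw [integral_const_mul, integral_comp_mul_left_Ioi (fun x : ℝ => (1 - Real.cos (x ^ 2)) / x ^ 2) 0
    (by positivity : 0 < √(2 * c)), mul_zero, integral_one_sub_cos_sq_div_sq, smul_eq_mul,
    Real.sqrt_mul (by norm_num), Real.sqrt_div Real.pi_pos.le, Real.sqrt_mul Real.pi_pos.le]
  have h1 : √2 * √2 = 2 := Real.mul_self_sqrt (by norm_num)
  have h2 : √c * √c = c := Real.mul_self_sqrt hc.le
  have h3 : √2 ≠ 0 := by positivity
  have h4 : √c ≠ 0 := by positivity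
  field_simp
  linear_combination (-2) * h2 - √c ^ 2 * h1

lemma hasSum_riemannZeta_three_half :
    HasSum (fun k : ℕ => 1 / (k : ℝ) ^ (3 / 2 : ℝ)) (riemannZeta (3 / 2)).re := by
  have hs : Summable (fun k : ℕ => 1 / (k : ℝ) ^ (3 / 2 : ℝ)) :=
    Real.summable_one_div_nat_rpow.2 (by norm_num)
  have h : riemannZeta (3 / 2) = ((∑' k : ℕ, 1 / (k : ℝ) ^ (3 / 2 : ℝ) : ℝ) : ℂ) := by
    rw [zeta_eq_tsum_one_div_nat_cpow (by norm_num), Complex.ofReal_tsum]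
    refine tsum_congr fun k => ?_
    rw [Complex.ofReal_div, Complex.ofReal_cpow (Nat.cast_nonneg k)]
    norm_num
  rw [h, Complex.ofReal_re]
  exact hs.hasSum

lemma integral_sin_sq_term (k : ℕ) :
    IntegrableOn (fun x : ℝ => Real.sin (Real.pi * k * x ^ 2) ^ 2 / (k : ℝ) ^ 2 / x ^ 2) (Set.Ioi 0) ∧
    ∫ x : ℝ in Set.Ioi 0, Real.sin (Real.pi * k * x ^ 2) ^ 2 / (k : ℝ) ^ 2 / x ^ 2
      = Real.pi / 2 * (1 / (k : ℝ) ^ (3 / 2 : ℝ)) := by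
  rcases Nat.eq_zero_or_pos k with rfl | hk
  · simp
  have hk' : (0 : ℝ) < k := by exact_mod_cast hk
  have hc : 0 < Real.pi * k := by positivity
  have e : ∀ x : ℝ, Real.sin (Real.pi * k * x ^ 2) ^ 2 / (k : ℝ) ^ 2 / x ^ 2
      = ((k : ℝ) ^ 2)⁻¹ * (Real.sin (Real.pi * k * x ^ 2) ^ 2 / x ^ 2) := fun x => by ring
  simp only [e]
  refine ⟨(integrable_sin_sq_mul_sq_div_sq hc).const_mul _, ?_⟩
  rw [integral_const_mul, integral_sin_sq_mul_sq_div_sq hc, ← mul_assoc,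
    Real.sqrt_mul (by positivity), Real.sqrt_mul_self Real.pi_pos.le]
  have h : (k : ℝ) ^ 2 = (k : ℝ) ^ (3 / 2 : ℝ) * √k := by
    rw [Real.sqrt_eq_rpow, ← Real.rpow_add hk', ← Real.rpow_natCast]
    norm_num
  rw [h]
  have : √(k : ℝ) ≠ 0 := by positivity
  field_simp

lemma integral_fractBump_inv_sq :
    ∫ u : ℝ in Set.Ioi 0, fractBump (1 / u ^ 2) = (riemannZeta (3 / 2)).re / Real.pi := by
  have h1 := integral_comp_rpow_Ioi (fun u : ℝ => fractBump (1 / u ^ 2)) (p := -1) (by norm_num)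
  rw [← h1]
  have h2 := hasSum_integral_of_summable_integral_norm
    (μ := volume.restrict (Set.Ioi (0 : ℝ)))
    (F := fun (k : ℕ) (x : ℝ) => Real.sin (Real.pi * k * x ^ 2) ^ 2 / (k : ℝ) ^ 2 / x ^ 2)
    (fun k => (integral_sin_sq_term k).1) (by
      have : ∀ (k : ℕ) (x : ℝ), ‖Real.sin (Real.pi * k * x ^ 2) ^ 2 / (k : ℝ) ^ 2 / x ^ 2‖
          = Real.sin (Real.pi * k * x ^ 2) ^ 2 / (k : ℝ) ^ 2 / x ^ 2 :=
        fun k x => Real.norm_of_nonneg (by positivity)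
      simp only [this, (integral_sin_sq_term _).2]
      exact hasSum_riemannZeta_three_half.summable.mul_left _)
  simp only [(integral_sin_sq_term _).2] at h2
  have h3 := h2.unique (hasSum_riemannZeta_three_half.mul_left _)
  have h4 : ∀ x : ℝ, ∑' k : ℕ, Real.sin (Real.pi * k * x ^ 2) ^ 2 / (k : ℝ) ^ 2 / x ^ 2
      = Real.pi ^ 2 / 2 * (fractBump (x ^ 2) / x ^ 2) := fun x => by
    rw [((hasSum_sin_sq_div_sq (x ^ 2)).div_const (x ^ 2)).tsum_eq]
    ring
  simp only [h4, integral_const_mul] at h3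
  have h5 : ∫ x : ℝ in Set.Ioi 0, (|(-1 : ℝ)| * x ^ ((-1 : ℝ) - 1)) • fractBump (1 / (x ^ (-1 : ℝ)) ^ 2)
      = ∫ x : ℝ in Set.Ioi 0, fractBump (x ^ 2) / x ^ 2 := by
    refine setIntegral_congr_fun measurableSet_Ioi fun x hx => ?_
    have hx : 0 < x := hx
    have e : x ^ ((-1 : ℝ) - 1) = (x ^ 2)⁻¹ := by
      rw [show (-1 : ℝ) - 1 = -((2 : ℕ) : ℝ) by norm_num, Real.rpow_neg hx.le, Real.rpow_natCast]
    simp only [e, Real.rpow_neg_one, smul_eq_mul, abs_neg, abs_one, one_mul]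
    rw [inv_pow, one_div, inv_inv, div_eq_inv_mul]
  rw [h5]
  have := Real.pi_pos
  field_simp
  field_simp at h3
  linarith

lemma integrable_fractBump_div_sq {T : ℝ} (hT : 0 ≤ T) :
    IntegrableOn (fun u : ℝ => fractBump (T / u ^ 2)) (Set.Ioi 0) := by
  refine Integrable.mono' (g := fun x => (2 + 2 * T) * (1 + x ^ 2)⁻¹)
    ((integrable_inv_one_add_sq.const_mul _).integrableOn)
    (Measurable.aestronglyMeasurable (continuous_fractBump.measurable.comp (by fun_prop))) ?_
  filter_upwards [ae_restrict_mem measurableSet_Ioi] with x hx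
  have hx : 0 < x := hx
  have hx2 : 0 < x ^ 2 := by positivity
  rw [Real.norm_of_nonneg (fractBump_nonneg _), ← div_eq_mul_inv, le_div_iff₀ (by positivity)]
  have h1 := fractBump_le_one (T / x ^ 2)
  have h0 := fractBump_nonneg (T / x ^ 2)
  have h2 : fractBump (T / x ^ 2) * x ^ 2 ≤ T := by
    have := fractBump_le_rpow (x := T / x ^ 2) (t := 1) (by positivity) zero_le_one le_rfl
    rwa [Real.rpow_one, le_div_iff₀ hx2] at this
  nlinarith

lemma integral_fractBump_div_sq {T : ℝ} (hT : 0 < T) :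
    ∫ u : ℝ in Set.Ioi 0, fractBump (T / u ^ 2)
      = (riemannZeta (3 / 2)).re / Real.pi * √T := by
  have h := integral_comp_mul_left_Ioi (fun u : ℝ => fractBump (T / u ^ 2)) 0
    (by positivity : 0 < √T)
  rw [mul_zero] at h
  have e : ∀ x : ℝ, fractBump (T / (√T * x) ^ 2) = fractBump (1 / x ^ 2) := fun x => by
    rw [mul_pow, Real.sq_sqrt hT.le, ← div_div, div_self hT.ne']
  simp only [e, smul_eq_mul] at h
  rw [← integral_fractBump_inv_sq, h]
  field_simp

lemma le_rpow_of_le_one_of_le {x y t : ℝ} (hx : 0 ≤ x) (hy : y ≤ 1) (hyx : y ≤ x)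
    (ht0 : 0 ≤ t) (ht1 : t ≤ 1) : y ≤ x ^ t := by
  rcases le_total 1 x with h | h
  · exact hy.trans (Real.one_le_rpow h ht0)
  · rcases eq_or_lt_of_le hx with rfl | hx'
    · exact hyx.trans (Real.rpow_nonneg le_rfl t)
    · exact hyx.trans (by simpa using Real.rpow_le_rpow_of_exponent_ge hx' h ht1)

lemma fractBump_div_sq_le {T : ℝ} (hT : 0 ≤ T) (m : ℕ) :
    fractBump (T / (m : ℝ) ^ 2) ≤ T * (1 / (m : ℝ) ^ 2) := by
  have := fractBump_le_rpow (x := T / (m : ℝ) ^ 2) (t := 1) (by positivity) zero_le_one le_rfl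
  rw [Real.rpow_one] at this
  rw [mul_one_div]
  exact this

lemma summable_fractBump_div_sq {T : ℝ} (hT : 0 ≤ T) :
    Summable (fun m : ℕ => fractBump (T / (m : ℝ) ^ 2)) :=
  Summable.of_nonneg_of_le (fun _ => fractBump_nonneg _) (fractBump_div_sq_le hT)
    ((Real.summable_one_div_nat_pow.2 one_lt_two).mul_left T)

lemma abs_fractBump_sub_integral_le {T : ℝ} (hT : 1 ≤ T) (m : ℕ) :
    |fractBump (T / ((m + 1 : ℕ) : ℝ) ^ 2) - ∫ u in (m : ℝ)..((m + 1 : ℕ) : ℝ), fractBump (T / u ^ 2)|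
      ≤ (8 * T) ^ (2 / 5 : ℝ) * (1 / ((m + 1 : ℕ) : ℝ) ^ (6 / 5 : ℝ)) := by
  have hm1 : (0 : ℝ) < ((m + 1 : ℕ) : ℝ) := by positivity
  have h_int : IntervalIntegrable (fun u : ℝ => fractBump (T / u ^ 2)) volume
      (m : ℝ) ((m + 1 : ℕ) : ℝ) := by
    rw [intervalIntegrable_iff_integrableOn_Ioc_of_le (by simp)]
    exact (integrable_fractBump_div_sq (by linarith)).mono_set fun u hu =>
      lt_of_le_of_lt (Nat.cast_nonneg m) hu.1
  have e : fractBump (T / ((m + 1 : ℕ) : ℝ) ^ 2)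
      - ∫ u in (m : ℝ)..((m + 1 : ℕ) : ℝ), fractBump (T / u ^ 2)
      = ∫ u in (m : ℝ)..((m + 1 : ℕ) : ℝ),
        (fractBump (T / ((m + 1 : ℕ) : ℝ) ^ 2) - fractBump (T / u ^ 2)) := by
    rw [intervalIntegral.integral_sub intervalIntegrable_const h_int]
    simp
  rw [e]
  have hpow : (8 * T) ^ (2 / 5 : ℝ) * (1 / ((m + 1 : ℕ) : ℝ) ^ (6 / 5 : ℝ))
      = (8 * T / ((m + 1 : ℕ) : ℝ) ^ 3) ^ (2 / 5 : ℝ) := by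
    rw [Real.div_rpow (by positivity) (by positivity), ← Real.rpow_natCast, ← Real.rpow_mul hm1.le,
      mul_one_div]
    norm_num
  have hb := intervalIntegral.norm_integral_le_of_norm_le_const (a := (m : ℝ))
    (b := ((m + 1 : ℕ) : ℝ))
    (f := fun u => fractBump (T / ((m + 1 : ℕ) : ℝ) ^ 2) - fractBump (T / u ^ 2))
    (C := (8 * T / ((m + 1 : ℕ) : ℝ) ^ 3) ^ (2 / 5 : ℝ)) (fun u hu => ?_)
  · rw [hpow]
    simpa using hb
  rw [Set.uIoc_of_le (by simp)] at hu
  have hu0 : 0 < u := lt_of_le_of_lt (Nat.cast_nonneg m) hu.1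
  rw [Real.norm_eq_abs]
  have habs : |fractBump (T / ((m + 1 : ℕ) : ℝ) ^ 2) - fractBump (T / u ^ 2)| ≤ 1 := by
    have h1 := fractBump_nonneg (T / ((m + 1 : ℕ) : ℝ) ^ 2)
    have h2 := fractBump_le_one (T / ((m + 1 : ℕ) : ℝ) ^ 2)
    have h3 := fractBump_nonneg (T / u ^ 2)
    have h4 := fractBump_le_one (T / u ^ 2)
    exact abs_le.2 ⟨by linarith, by linarith⟩
  refine le_rpow_of_le_one_of_le (by positivity) habs ?_ (by norm_num) (by norm_num)
  rcases Nat.eq_zero_or_pos m with rfl | hm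
  · refine habs.trans ?_
    norm_num
    linarith
  refine (abs_fractBump_sub_le _ _).trans ?_
  have hm' : (1 : ℝ) ≤ m := by exact_mod_cast hm
  have hum : (m : ℝ) < u := hu.1
  have hum1 : u ≤ m + 1 := by simpa using hu.2
  push_cast at hm1 ⊢
  have hle : T / ((m : ℝ) + 1) ^ 2 ≤ T / u ^ 2 := by gcongr
  rw [abs_sub_comm, abs_of_nonneg (by linarith)]
  have hle2 : T / u ^ 2 ≤ T / (m : ℝ) ^ 2 := by gcongr
  have : T / (m : ℝ) ^ 2 - T / ((m : ℝ) + 1) ^ 2 ≤ 8 * T / ((m : ℝ) + 1) ^ 3 := by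
    have hm0 : (0 : ℝ) < m := by linarith
    rw [div_sub_div _ _ (by positivity) (by positivity), div_le_div_iff₀ (by positivity) (by positivity)]
    have : 0 ≤ T * (m + 1 : ℝ) ^ 2 * (8 * (m : ℝ) ^ 2 - (2 * m + 1) * (m + 1)) :=
      mul_nonneg (by positivity) (by nlinarith)
    nlinarith
  linarith

lemma exists_abs_tsum_fractBump_sub_le :
    ∃ A : ℝ, 0 < A ∧ ∀ T : ℝ, 0 < T →
      |∑' m : ℕ, fractBump (T / (m : ℝ) ^ 2) - (riemannZeta (3 / 2)).re / Real.pi * √T|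
        ≤ A * T ^ (2 / 5 : ℝ) := by
  set c : ℝ := (riemannZeta (3 / 2)).re / Real.pi with hc
  set Z : ℝ := ∑' m : ℕ, 1 / (m : ℝ) ^ 2 with hZ
  have hs65 : Summable fun m : ℕ => 1 / ((m + 1 : ℕ) : ℝ) ^ (6 / 5 : ℝ) :=
    (summable_nat_add_iff 1).2 (Real.summable_one_div_nat_rpow.2 (by norm_num))
  set W : ℝ := ∑' m : ℕ, 1 / ((m + 1 : ℕ) : ℝ) ^ (6 / 5 : ℝ) with hW
  have hZ0 : 0 ≤ Z := tsum_nonneg fun m => by positivity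
  have hW0 : 0 ≤ W := tsum_nonneg fun m => by positivity
  refine ⟨Z + |c| + 8 ^ (2 / 5 : ℝ) * W + 1, by positivity, fun T hT => ?_⟩
  have hT25 : 0 ≤ T ^ (2 / 5 : ℝ) := by positivity
  have h8 : (0 : ℝ) ≤ 8 ^ (2 / 5 : ℝ) * W := by positivity
  rcases le_total T 1 with h | h
  · have h1 : ∑' m : ℕ, fractBump (T / (m : ℝ) ^ 2) ≤ Z * T ^ (2 / 5 : ℝ) := by
      calc ∑' m : ℕ, fractBump (T / (m : ℝ) ^ 2) ≤ ∑' m : ℕ, T * (1 / (m : ℝ) ^ 2) :=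
            (summable_fractBump_div_sq hT.le).tsum_le_tsum (fractBump_div_sq_le hT.le)
              ((Real.summable_one_div_nat_pow.2 one_lt_two).mul_left T)
        _ = Z * T ^ (1 : ℝ) := by rw [tsum_mul_left, Real.rpow_one, mul_comm]
        _ ≤ Z * T ^ (2 / 5 : ℝ) := by
            gcongr ?_ * ?_
            exact Real.rpow_le_rpow_of_exponent_ge hT h (by norm_num)
    have h0 : 0 ≤ ∑' m : ℕ, fractBump (T / (m : ℝ) ^ 2) := tsum_nonneg fun _ => fractBump_nonneg _
    have h2 : |c * √T| ≤ |c| * T ^ (2 / 5 : ℝ) := by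
      rw [abs_mul, abs_of_nonneg (Real.sqrt_nonneg T), Real.sqrt_eq_rpow]
      gcongr ?_ * ?_
      exact Real.rpow_le_rpow_of_exponent_ge hT h (by norm_num)
    refine (abs_sub _ _).trans ?_
    rw [abs_of_nonneg h0]
    nlinarith
  · have hlim1 : Filter.Tendsto
        (fun N : ℕ => ∑ m ∈ Finset.range N, fractBump (T / ((m + 1 : ℕ) : ℝ) ^ 2)) Filter.atTop
        (nhds (∑' m : ℕ, fractBump (T / (m : ℝ) ^ 2))) := by
      have hs := summable_fractBump_div_sq hT.le
      have : ∑' m : ℕ, fractBump (T / (m : ℝ) ^ 2)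
          = ∑' m : ℕ, fractBump (T / ((m + 1 : ℕ) : ℝ) ^ 2) := by
        rw [hs.tsum_eq_zero_add]
        simp [fractBump_zero]
      rw [this]
      exact ((summable_nat_add_iff 1).2 hs).hasSum.tendsto_sum_nat
    have hlim2 := intervalIntegral_tendsto_integral_Ioi (μ := volume) 0
      (integrable_fractBump_div_sq hT.le) (tendsto_natCast_atTop_atTop (R := ℝ))
    rw [integral_fractBump_div_sq hT] at hlim2
    refine le_of_tendsto (hlim1.sub hlim2).abs (Filter.Eventually.of_forall fun N => ?_)
    have hadj := intervalIntegral.sum_integral_adjacent_intervals (μ := volume)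
      (f := fun u : ℝ => fractBump (T / u ^ 2)) (a := fun n : ℕ => (n : ℝ)) (n := N)
      (fun k _ => by
        rw [intervalIntegrable_iff_integrableOn_Ioc_of_le (by simp)]
        exact (integrable_fractBump_div_sq hT.le).mono_set fun u hu =>
          lt_of_le_of_lt (Nat.cast_nonneg k) hu.1)
    simp only [Nat.cast_zero] at hadj
    rw [← hadj, ← Finset.sum_sub_distrib]
    calc _ ≤ ∑ m ∈ Finset.range N, (8 * T) ^ (2 / 5 : ℝ) * (1 / ((m + 1 : ℕ) : ℝ) ^ (6 / 5 : ℝ)) :=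
          (Finset.abs_sum_le_sum_abs _ _).trans
            (Finset.sum_le_sum fun m _ => abs_fractBump_sub_integral_le h m)
      _ ≤ (8 * T) ^ (2 / 5 : ℝ) * W := by
          rw [← Finset.mul_sum]
          gcongr
          exact hs65.sum_le_tsum _ fun m _ => by positivity
      _ ≤ _ := by
          rw [Real.mul_rpow (by norm_num) hT.le]
          nlinarith [abs_nonneg c]

lemma sq_dvd_sq_mul_iff_of_squarefree {a b e : ℕ} (hb : b ≠ 0) (ha : Squarefree a) :
    e ^ 2 ∣ b ^ 2 * a ↔ e ∣ b := by
  refine ⟨fun h => ?_, fun h => (pow_dvd_pow_of_dvd h 2).mul_right a⟩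
  obtain ⟨g, e', b', hg, hcop, rfl, rfl⟩ :=
    Nat.exists_coprime' (m := e) (n := b) (Nat.gcd_pos_of_pos_right e (Nat.pos_of_ne_zero hb))
  have h1 : e' ^ 2 ∣ b' ^ 2 * a := by
    have : (e' ^ 2) * g ^ 2 ∣ (b' ^ 2 * a) * g ^ 2 := by
      convert h using 1 <;> ring
    exact Nat.dvd_of_mul_dvd_mul_right (by positivity) this
  have h2 : e' ^ 2 ∣ a := (Nat.Coprime.pow 2 2 hcop).dvd_of_dvd_mul_left h1
  have h3 : e' = 1 := Nat.isUnit_iff.1 (ha e' (by rwa [← sq]))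
  rw [h3, one_mul]
  exact dvd_mul_left g b'

lemma hasSum_moebius_sq_dvd {N : ℕ} (hN : N ≠ 0) :
    HasSum (fun e : ℕ => if e ^ 2 ∣ N then (ArithmeticFunction.moebius e : ℝ) else 0)
      ((ArithmeticFunction.moebius N : ℝ) ^ 2) := by
  obtain ⟨a, b, rfl, ha⟩ := Nat.sq_mul_squarefree N
  have hb : b ≠ 0 := by
    rintro rfl
    simp at hN
  have hval : ((ArithmeticFunction.moebius (b ^ 2 * a) : ℝ)) ^ 2
      = ∑ e ∈ b.divisors, (ArithmeticFunction.moebius e : ℝ) := by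
    have h1 : ∑ e ∈ b.divisors, ArithmeticFunction.moebius e = if b = 1 then 1 else 0 := by
      rw [← ArithmeticFunction.coe_mul_zeta_apply, ArithmeticFunction.moebius_mul_coe_zeta,
        ArithmeticFunction.one_apply]
    have h2 : ArithmeticFunction.moebius (b ^ 2 * a) ^ 2 = if b = 1 then 1 else 0 := by
      rw [ArithmeticFunction.moebius_sq]
      refine if_congr ⟨fun h => ?_, ?_⟩ rfl rfl
      · exact Nat.isUnit_iff.1 (h b (by rw [← sq]; exact dvd_mul_right _ _))
      · rintro rfl
        simpa using ha
    exact_mod_cast h2.trans h1.symm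
  rw [hval, Finset.sum_congr rfl (g := fun e : ℕ =>
    if e ^ 2 ∣ b ^ 2 * a then (ArithmeticFunction.moebius e : ℝ) else 0)]
  · refine hasSum_sum_of_ne_finset_zero fun e he => if_neg ?_
    rw [sq_dvd_sq_mul_iff_of_squarefree hb ha]
    simpa [hb] using he
  · intro e he
    rw [if_pos]
    rw [sq_dvd_sq_mul_iff_of_squarefree hb ha]
    exact Nat.dvd_of_mem_divisors he

lemma dvd_mul_iff_div_gcd_dvd {d g n : ℕ} (hd : d ≠ 0) :
    d ∣ g * n ↔ d / Nat.gcd d n ∣ g := by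
  obtain ⟨q, r, hcop, hq, hr⟩ := Nat.exists_coprime d n
  have hpos : 0 < Nat.gcd d n := Nat.gcd_pos_of_pos_left n (Nat.pos_of_ne_zero hd)
  generalize Nat.gcd d n = c at hq hr hpos
  subst hq hr
  rw [Nat.mul_div_cancel _ hpos, ← mul_assoc, Nat.mul_dvd_mul_iff_right hpos]
  exact ⟨hcop.dvd_of_dvd_mul_right, fun h => h.mul_right r⟩

/-- The least `k` such that `e² ∣ g n` if and only if `k ∣ g`. -/
def sqDivGcd (e n : ℕ) : ℕ := e ^ 2 / Nat.gcd (e ^ 2) n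

lemma cast_sqDivGcd (e n : ℕ) : (sqDivGcd e n : ℝ) = (e : ℝ) ^ 2 / (Nat.gcd (e ^ 2) n : ℝ) := by
  rw [sqDivGcd, Nat.cast_div_charZero (Nat.gcd_dvd_left _ _), Nat.cast_pow]

lemma sqDivGcd_pos {e : ℕ} (n : ℕ) (he : e ≠ 0) : 0 < sqDivGcd e n := by
  have h : 0 < e ^ 2 := by positivity
  exact Nat.div_pos (Nat.gcd_le_left n h) (Nat.gcd_pos_of_pos_left n h)

lemma one_div_sqDivGcd_le {n : ℕ} (hn : n ≠ 0) (e : ℕ) :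
    1 / (sqDivGcd e n : ℝ) ≤ n * (1 / (e : ℝ) ^ 2) := by
  rw [cast_sqDivGcd, one_div_div, mul_one_div]
  gcongr
  exact Nat.gcd_le_right _ (Nat.pos_of_ne_zero hn)

lemma abs_moebius_cast_le_one (n : ℕ) : |(ArithmeticFunction.moebius n : ℝ)| ≤ 1 := by
  exact_mod_cast ArithmeticFunction.abs_moebius_le_one (n := n)

lemma summable_moebius_div_sqDivGcd {n : ℕ} (hn : n ≠ 0) :
    Summable fun e : ℕ => (ArithmeticFunction.moebius e : ℝ) * (1 / (sqDivGcd e n : ℝ)) := by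
  refine Summable.of_norm_bounded
    (g := fun e : ℕ => (n : ℝ) * (1 / (e : ℝ) ^ 2))
    ((Real.summable_one_div_nat_pow.2 one_lt_two).mul_left _) fun e => ?_
  rw [norm_mul, Real.norm_eq_abs, Real.norm_of_nonneg (by positivity)]
  exact (mul_le_of_le_one_left (by positivity) (abs_moebius_cast_le_one e)).trans
    (one_div_sqDivGcd_le hn e)

lemma tsum_ite_dvd_eq {f : ℕ → ℝ} {k : ℕ} (hk : 0 < k) :
    ∑' g : ℕ, (if k ∣ g then f g else 0) = ∑' m : ℕ, f (k * m) := by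
  have hinj : Function.Injective fun m : ℕ => k * m := fun a b h =>
    Nat.eq_of_mul_eq_mul_left hk h
  rw [← hinj.tsum_eq (f := fun g : ℕ => if k ∣ g then f g else 0)]
  · simp
  · intro g hg
    by_contra h
    refine hg (if_neg fun hd => h ?_)
    obtain ⟨m, rfl⟩ := hd
    exact ⟨m, rfl⟩

lemma tsum_moebius_sq_mul_fractBump {H : ℝ} (hH : 0 ≤ H) {n : ℕ} (hn : n ≠ 0) :
    ∑' g : ℕ, (ArithmeticFunction.moebius (g * n) : ℝ) ^ 2 * fractBump (H / (g : ℝ) ^ 2)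
      = ∑' e : ℕ, (ArithmeticFunction.moebius e : ℝ) *
          ∑' m : ℕ, fractBump (H / (sqDivGcd e n : ℝ) ^ 2 / (m : ℝ) ^ 2) := by
  set F : ℕ → ℕ → ℝ := fun g e =>
    (if e ^ 2 ∣ g * n then (ArithmeticFunction.moebius e : ℝ) else 0) * fractBump (H / (g : ℝ) ^ 2)
    with hF
  have hsum : Summable (Function.uncurry F) := by
    have h1 : Summable fun g : ℕ => (H * (n : ℝ) ^ (3 / 5 : ℝ)) * (1 / (g : ℝ) ^ (7 / 5 : ℝ)) :=
      (Real.summable_one_div_nat_rpow.2 (by norm_num)).mul_left _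
    have h2 : Summable fun e : ℕ => 1 / (e : ℝ) ^ (6 / 5 : ℝ) :=
      Real.summable_one_div_nat_rpow.2 (by norm_num)
    refine Summable.of_norm_bounded (h1.mul_of_nonneg h2 (fun g => by positivity)
      (fun e => by positivity)) ?_
    rintro ⟨g, e⟩
    simp only [Function.uncurry, hF]
    rcases Nat.eq_zero_or_pos g with rfl | hg
    · simp [fractBump_zero]
    rcases Nat.eq_zero_or_pos e with rfl | he
    · simp
    split_ifs with hd
    · have hle : e ^ 2 ≤ g * n :=
        Nat.le_of_dvd (Nat.mul_pos hg (Nat.pos_of_ne_zero hn)) hd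
      have hle' : (e : ℝ) ^ 2 ≤ g * n := by exact_mod_cast hle
      have hg' : (0 : ℝ) < g := by exact_mod_cast hg
      have he' : (0 : ℝ) < e := by exact_mod_cast he
      rw [norm_mul, Real.norm_eq_abs, Real.norm_of_nonneg (fractBump_nonneg _)]
      have h3 := fractBump_div_sq_le hH g
      have h4 : (e : ℝ) ^ (6 / 5 : ℝ) ≤ (g : ℝ) ^ (3 / 5 : ℝ) * (n : ℝ) ^ (3 / 5 : ℝ) := by
        rw [← Real.mul_rpow (by positivity) (by positivity)]
        calc (e : ℝ) ^ (6 / 5 : ℝ) = ((e : ℝ) ^ 2) ^ (3 / 5 : ℝ) := by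
              rw [← Real.rpow_natCast, ← Real.rpow_mul he'.le]
              norm_num
          _ ≤ _ := Real.rpow_le_rpow (by positivity) hle' (by norm_num)
      have h5 : (g : ℝ) ^ 2 = (g : ℝ) ^ (7 / 5 : ℝ) * (g : ℝ) ^ (3 / 5 : ℝ) := by
        rw [← Real.rpow_add hg', ← Real.rpow_natCast]
        norm_num
      calc _ ≤ 1 * (H * (1 / (g : ℝ) ^ 2)) := by
            gcongr
            · exact fractBump_nonneg _
            · exact abs_moebius_cast_le_one e
        _ ≤ _ := by
            have h6 : (0 : ℝ) < (g : ℝ) ^ (7 / 5 : ℝ) := by positivity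
            have h7 : (0 : ℝ) < (g : ℝ) ^ (3 / 5 : ℝ) := by positivity
            have h8 : (0 : ℝ) < (e : ℝ) ^ (6 / 5 : ℝ) := by positivity
            rw [h5, one_mul, mul_one_div, mul_one_div, mul_one_div, div_div,
              div_le_div_iff₀ (by positivity) (by positivity)]
            nlinarith [mul_le_mul_of_nonneg_left h4 (mul_nonneg hH h6.le)]
    · simp only [zero_mul, norm_zero]
      positivity
  have h1 : ∀ g : ℕ, ∑' e : ℕ, F g e
      = (ArithmeticFunction.moebius (g * n) : ℝ) ^ 2 * fractBump (H / (g : ℝ) ^ 2) := by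
    intro g
    simp only [hF]
    rw [tsum_mul_right]
    rcases Nat.eq_zero_or_pos g with rfl | hg
    · simp [fractBump_zero]
    · rw [(hasSum_moebius_sq_dvd (Nat.mul_ne_zero hg.ne' hn)).tsum_eq]
  rw [← tsum_congr h1, ← hsum.tsum_comm]
  refine tsum_congr fun e => ?_
  rcases Nat.eq_zero_or_pos e with rfl | he
  · simp [hF]
  have hk := sqDivGcd_pos n he.ne'
  have h2 : ∀ g : ℕ, F g e = (ArithmeticFunction.moebius e : ℝ) *
      (if sqDivGcd e n ∣ g then fractBump (H / (g : ℝ) ^ 2) else 0) := by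
    intro g
    have h3 : e ^ 2 ∣ g * n ↔ sqDivGcd e n ∣ g := dvd_mul_iff_div_gcd_dvd (pow_pos he 2).ne'
    by_cases h4 : e ^ 2 ∣ g * n
    · simp only [hF, if_pos h4, if_pos (h3.1 h4)]
    · simp only [hF, if_neg h4, if_neg (fun h => h4 (h3.2 h)), zero_mul, mul_zero]
  rw [tsum_congr h2, tsum_mul_left, tsum_ite_dvd_eq (f := fun g => fractBump (H / (g : ℝ) ^ 2)) hk]
  congr 1
  refine tsum_congr fun m => ?_
  rw [Nat.cast_mul, mul_pow, div_div]

/-- The density constant of the integers `g` such that `g n` is squarefree. -/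
noncomputable def sqfDensity (n : ℕ) : ℝ :=
  ∑' e : ℕ, (ArithmeticFunction.moebius e : ℝ) * (1 / (sqDivGcd e n : ℝ))

lemma exists_abs_tsum_moebius_sq_mul_fractBump_sub_le :
    ∃ A : ℝ, 0 < A ∧ ∀ H : ℝ, 0 < H → ∀ n : ℕ, n ≠ 0 →
      |∑' g : ℕ, (ArithmeticFunction.moebius (g * n) : ℝ) ^ 2 * fractBump (H / (g : ℝ) ^ 2)
          - (riemannZeta (3 / 2)).re / Real.pi * √H * sqfDensity n|
        ≤ A * H ^ (2 / 5 : ℝ) * (n : ℝ) ^ (4 / 5 : ℝ) := by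
  obtain ⟨A, hA, hbound⟩ := exists_abs_tsum_fractBump_sub_le
  set c : ℝ := (riemannZeta (3 / 2)).re / Real.pi with hc
  have hs : Summable fun e : ℕ => 1 / (e : ℝ) ^ (8 / 5 : ℝ) :=
    Real.summable_one_div_nat_rpow.2 (by norm_num)
  set W : ℝ := ∑' e : ℕ, 1 / (e : ℝ) ^ (8 / 5 : ℝ) with hW
  have hW0 : 0 ≤ W := tsum_nonneg fun e => by positivity
  refine ⟨A * (W + 1), by positivity, fun H hH n hn => ?_⟩
  have hmain : Summable fun e : ℕ =>
      c * √H * ((ArithmeticFunction.moebius e : ℝ) * (1 / (sqDivGcd e n : ℝ))) :=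
    (summable_moebius_div_sqDivGcd hn).mul_left _
  set G : ℕ → ℝ := fun e => (ArithmeticFunction.moebius e : ℝ) *
    ∑' m : ℕ, fractBump (H / (sqDivGcd e n : ℝ) ^ 2 / (m : ℝ) ^ 2) with hG
  have hterm : ∀ e : ℕ,
      ‖G e - c * √H * ((ArithmeticFunction.moebius e : ℝ) * (1 / (sqDivGcd e n : ℝ)))‖
        ≤ A * H ^ (2 / 5 : ℝ) * (n : ℝ) ^ (4 / 5 : ℝ) * (1 / (e : ℝ) ^ (8 / 5 : ℝ)) := by
    intro e
    rcases Nat.eq_zero_or_pos e with rfl | he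
    · simp only [hG, ArithmeticFunction.map_zero, Int.cast_zero, zero_mul, mul_zero, sub_zero,
        norm_zero]
      positivity
    have he' : (0 : ℝ) < e := by exact_mod_cast he
    have hk : (0 : ℝ) < sqDivGcd e n := by exact_mod_cast sqDivGcd_pos n he.ne'
    have h1 := hbound (H / (sqDivGcd e n : ℝ) ^ 2) (by positivity)
    rw [Real.sqrt_div hH.le, Real.sqrt_sq hk.le] at h1
    have e1 : G e - c * √H * ((ArithmeticFunction.moebius e : ℝ) * (1 / (sqDivGcd e n : ℝ)))
        = (ArithmeticFunction.moebius e : ℝ) *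
          (∑' m : ℕ, fractBump (H / (sqDivGcd e n : ℝ) ^ 2 / (m : ℝ) ^ 2)
            - c * (√H / sqDivGcd e n)) := by
      simp only [hG]
      ring
    rw [e1, norm_mul, Real.norm_eq_abs, Real.norm_eq_abs]
    refine (mul_le_of_le_one_left (abs_nonneg _) (abs_moebius_cast_le_one e)).trans (h1.trans ?_)
    have h2 : (H / (sqDivGcd e n : ℝ) ^ 2) ^ (2 / 5 : ℝ)
        = H ^ (2 / 5 : ℝ) * (1 / (sqDivGcd e n : ℝ)) ^ (4 / 5 : ℝ) := by
      rw [div_eq_mul_one_div H, ← one_div_pow, Real.mul_rpow hH.le (by positivity),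
        ← Real.rpow_natCast (1 / (sqDivGcd e n : ℝ)), ← Real.rpow_mul (by positivity)]
      norm_num
    have h3 : (1 / (sqDivGcd e n : ℝ)) ^ (4 / 5 : ℝ)
        ≤ (n : ℝ) ^ (4 / 5 : ℝ) * (1 / (e : ℝ) ^ (8 / 5 : ℝ)) := by
      refine (Real.rpow_le_rpow (by positivity) (one_div_sqDivGcd_le hn e)
        (by norm_num)).trans_eq ?_
      rw [Real.mul_rpow (by positivity) (by positivity), Real.div_rpow zero_le_one (by positivity),
        Real.one_rpow, ← Real.rpow_natCast, ← Real.rpow_mul he'.le]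
      norm_num
    rw [h2]
    calc A * (H ^ (2 / 5 : ℝ) * (1 / (sqDivGcd e n : ℝ)) ^ (4 / 5 : ℝ))
        ≤ A * (H ^ (2 / 5 : ℝ) * ((n : ℝ) ^ (4 / 5 : ℝ) * (1 / (e : ℝ) ^ (8 / 5 : ℝ)))) := by
          gcongr
      _ = _ := by ring
  have hdiff : Summable fun e : ℕ =>
      G e - c * √H * ((ArithmeticFunction.moebius e : ℝ) * (1 / (sqDivGcd e n : ℝ))) :=
    Summable.of_norm_bounded (hs.mul_left _) hterm
  have hGs : Summable G := by
    refine (hdiff.add hmain).congr fun e => ?_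
    ring
  rw [tsum_moebius_sq_mul_fractBump hH.le hn, sqfDensity, ← tsum_mul_left, ← hGs.tsum_sub hmain]
  have := tsum_of_norm_bounded (hs.mul_left _).hasSum hterm
  rw [Real.norm_eq_abs, tsum_mul_left] at this
  refine this.trans ?_
  have hnn : 0 ≤ A * H ^ (2 / 5 : ℝ) * (n : ℝ) ^ (4 / 5 : ℝ) := by positivity
  rw [← hW]
  nlinarith

lemma hasSum_sum_divisorsAntidiagonal {f : ℕ × ℕ → ℝ} (h0 : ∀ x : ℕ × ℕ, x.1 * x.2 = 0 → f x = 0)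
    (hf : Summable f) :
    HasSum (fun m : ℕ => ∑ x ∈ m.divisorsAntidiagonal, f x) (∑' x, f x) := by
  refine ((Equiv.sigmaFiberEquiv fun x : ℕ × ℕ => x.1 * x.2).hasSum_iff.2 hf.hasSum).sigma
    fun m => ?_
  change HasSum (f ∘ ((↑) : {x : ℕ × ℕ | x.1 * x.2 = m} → ℕ × ℕ)) _
  rw [hasSum_subtype_iff_indicator, Finset.sum_congr rfl
    (g := Set.indicator {x : ℕ × ℕ | x.1 * x.2 = m} f)]
  · refine hasSum_sum_of_ne_finset_zero fun x hx => ?_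
    rw [Set.indicator_apply_eq_zero]
    intro hxm
    by_contra hne
    exact hx (Nat.mem_divisorsAntidiagonal.2 ⟨hxm, fun hm => hne (h0 x (hxm.trans hm))⟩)
  · intro x hx
    exact (Set.indicator_of_mem (s := {x : ℕ × ℕ | x.1 * x.2 = m})
      (Nat.mem_divisorsAntidiagonal.1 hx).1 f).symm

lemma card_divisorsAntidiagonal (n : ℕ) : n.divisorsAntidiagonal.card = n.divisors.card := by
  rw [Finset.card_eq_sum_ones, Finset.card_eq_sum_ones,
    Nat.sum_divisorsAntidiagonal (fun _ _ => 1)]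

lemma sum_divisorsAntidiagonal_mul_of_coprime {F : ℕ → ℕ → ℝ}
    (hF : ∀ a b c d : ℕ, Nat.Coprime (a * b) (c * d) → F (a * c) (b * d) = F a b * F c d)
    {m n : ℕ} (h : Nat.Coprime m n) :
    ∑ x ∈ (m * n).divisorsAntidiagonal, F x.1 x.2
      = (∑ x ∈ m.divisorsAntidiagonal, F x.1 x.2) * ∑ x ∈ n.divisorsAntidiagonal, F x.1 x.2 := by
  have hinj := h.mul_injOn_divisors
  rw [Nat.sum_divisorsAntidiagonal, Nat.sum_divisorsAntidiagonal, Nat.sum_divisorsAntidiagonal,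
    Nat.divisors_mul, Finset.mul_def, Finset.sum_image hinj, Finset.sum_mul_sum,
    ← Finset.sum_product']
  refine Finset.sum_congr rfl ?_
  rintro ⟨a, c⟩ hx
  obtain ⟨ha, hc⟩ := Finset.mem_product.1 hx
  have ha0 : 0 < a := Nat.pos_of_mem_divisors ha
  have hc0 : 0 < c := Nat.pos_of_mem_divisors hc
  obtain ⟨b, rfl⟩ : a ∣ m := Nat.dvd_of_mem_divisors ha
  obtain ⟨d, rfl⟩ : c ∣ n := Nat.dvd_of_mem_divisors hc
  simp only
  rw [Nat.mul_div_cancel_left _ ha0, Nat.mul_div_cancel_left _ hc0,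
    show a * b * (c * d) = a * c * (b * d) by ring,
    Nat.mul_div_cancel_left _ (Nat.mul_pos ha0 hc0)]
  exact hF a b c d h

/-- The terms of the double series behind the constant of the main term. -/
noncomputable def pairWeight (e n : ℕ) : ℝ :=
  (ArithmeticFunction.moebius e : ℝ) * (1 / (sqDivGcd e n : ℝ)) *
    ((ArithmeticFunction.moebius n : ℝ) * (n.divisors.card / (n : ℝ) ^ 2))

lemma sqDivGcd_mul_of_coprime {a b c d : ℕ} (h : Nat.Coprime (a * b) (c * d)) :
    (1 / (sqDivGcd (a * c) (b * d) : ℝ))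
      = 1 / (sqDivGcd a b : ℝ) * (1 / (sqDivGcd c d : ℝ)) := by
  have hac : Nat.Coprime (a ^ 2) (c ^ 2) :=
    Nat.Coprime.pow 2 2 (h.coprime_mul_right.coprime_mul_right_right)
  have had : Nat.Coprime (a ^ 2) d :=
    Nat.Coprime.pow_left 2 (h.coprime_mul_right.coprime_mul_left_right)
  have hcb : Nat.Coprime (c ^ 2) b :=
    Nat.Coprime.pow_left 2 (h.coprime_mul_left.coprime_mul_right_right.symm)
  have hg : Nat.gcd ((a * c) ^ 2) (b * d) = Nat.gcd (a ^ 2) b * Nat.gcd (c ^ 2) d := by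
    rw [mul_pow, hac.mul_gcd, Nat.Coprime.gcd_mul_right_cancel_right b had.symm,
      Nat.Coprime.gcd_mul_left_cancel_right d hcb.symm]
  rw [cast_sqDivGcd, cast_sqDivGcd, cast_sqDivGcd, hg, one_div_div, one_div_div, one_div_div]
  push_cast
  rw [mul_pow, mul_div_mul_comm]

lemma pairWeight_mul_of_coprime (a b c d : ℕ) (h : Nat.Coprime (a * b) (c * d)) :
    pairWeight (a * c) (b * d) = pairWeight a b * pairWeight c d := by
  have hac : Nat.Coprime a c := h.coprime_mul_right.coprime_mul_right_right
  have hbd : Nat.Coprime b d := h.coprime_mul_left.coprime_mul_left_right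
  simp only [pairWeight, sqDivGcd_mul_of_coprime h, hbd.card_divisors_mul,
    ArithmeticFunction.isMultiplicative_moebius.map_mul_of_coprime hac,
    ArithmeticFunction.isMultiplicative_moebius.map_mul_of_coprime hbd]
  push_cast
  rw [mul_pow, mul_div_mul_comm]
  ring

lemma summable_card_divisors_div_rpow :
    Summable fun n : ℕ => (n.divisors.card : ℝ) * (1 / (n : ℝ) ^ (5 / 4 : ℝ)) := by
  have h1 : Summable fun a : ℕ => 1 / (a : ℝ) ^ (5 / 4 : ℝ) :=
    Real.summable_one_div_nat_rpow.2 (by norm_num)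
  have h2 := h1.mul_of_nonneg h1 (fun a => by positivity) (fun a => by positivity)
  refine (hasSum_sum_divisorsAntidiagonal ?_ h2).summable.congr fun n => ?_
  · rintro ⟨a, b⟩ hab
    rcases Nat.mul_eq_zero.1 hab with rfl | rfl <;> simp
  · rw [Finset.sum_congr rfl (g := fun _ => 1 / (n : ℝ) ^ (5 / 4 : ℝ)), Finset.sum_const,
      nsmul_eq_mul, card_divisorsAntidiagonal]
    rintro ⟨a, b⟩ hab
    rw [← (Nat.mem_divisorsAntidiagonal.1 hab).1, Nat.cast_mul,
      Real.mul_rpow (by positivity) (by positivity), one_div_mul_one_div]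

lemma one_div_sqDivGcd_le_rpow {n : ℕ} (hn : n ≠ 0) (e : ℕ) :
    1 / (sqDivGcd e n : ℝ) ≤ (n : ℝ) ^ (3 / 4 : ℝ) * (1 / (e : ℝ) ^ (3 / 2 : ℝ)) := by
  rcases Nat.eq_zero_or_pos e with rfl | he
  · rw [sqDivGcd]
    simp
  replace hn : 0 < n := Nat.pos_of_ne_zero hn
  have he' : (0 : ℝ) < e := by exact_mod_cast he
  have hg : (Nat.gcd (e ^ 2) n : ℝ) ≤ (e : ℝ) ^ (1 / 2 : ℝ) * (n : ℝ) ^ (3 / 4 : ℝ) := by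
    have h3 : (Nat.gcd (e ^ 2) n : ℝ) ≤ (e : ℝ) ^ 2 := by
      exact_mod_cast Nat.gcd_le_left n (pow_pos he 2)
    have h4 : (Nat.gcd (e ^ 2) n : ℝ) ≤ n := by exact_mod_cast Nat.gcd_le_right (e ^ 2) hn
    have h5 : (0 : ℝ) < Nat.gcd (e ^ 2) n := by
      exact_mod_cast Nat.gcd_pos_of_pos_right (e ^ 2) hn
    calc (Nat.gcd (e ^ 2) n : ℝ)
        = (Nat.gcd (e ^ 2) n : ℝ) ^ (1 / 4 : ℝ) * (Nat.gcd (e ^ 2) n : ℝ) ^ (3 / 4 : ℝ) := by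
          rw [← Real.rpow_add h5]
          norm_num
      _ ≤ ((e : ℝ) ^ 2) ^ (1 / 4 : ℝ) * (n : ℝ) ^ (3 / 4 : ℝ) := by gcongr
      _ = _ := by
          rw [← Real.rpow_natCast, ← Real.rpow_mul he'.le]
          norm_num
  have e2 : (e : ℝ) ^ 2 = (e : ℝ) ^ (1 / 2 : ℝ) * (e : ℝ) ^ (3 / 2 : ℝ) := by
    rw [← Real.rpow_add he', ← Real.rpow_natCast]
    norm_num
  have h6 : (e : ℝ) ^ (1 / 2 : ℝ) ≠ 0 := by positivity
  calc 1 / (sqDivGcd e n : ℝ) = (Nat.gcd (e ^ 2) n : ℝ) / (e : ℝ) ^ 2 := by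
        rw [cast_sqDivGcd, one_div_div]
    _ ≤ (e : ℝ) ^ (1 / 2 : ℝ) * (n : ℝ) ^ (3 / 4 : ℝ) / (e : ℝ) ^ 2 := by gcongr
    _ = _ := by
        rw [e2]
        field_simp

lemma norm_moebius_mul_le {x : ℝ} (hx : 0 ≤ x) (n : ℕ) :
    ‖(ArithmeticFunction.moebius n : ℝ) * x‖ ≤ x := by
  rw [norm_mul, Real.norm_eq_abs, Real.norm_of_nonneg hx]
  exact mul_le_of_le_one_left hx (abs_moebius_cast_le_one n)

lemma exists_abs_sqfDensity_le :
    ∃ A : ℝ, 0 ≤ A ∧ ∀ n : ℕ, n ≠ 0 → |sqfDensity n| ≤ A * (n : ℝ) ^ (3 / 4 : ℝ) := by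
  have h1 : Summable fun e : ℕ => 1 / (e : ℝ) ^ (3 / 2 : ℝ) :=
    Real.summable_one_div_nat_rpow.2 (by norm_num)
  refine ⟨∑' e : ℕ, 1 / (e : ℝ) ^ (3 / 2 : ℝ), tsum_nonneg fun e => by positivity,
    fun n hn => ?_⟩
  have := tsum_of_norm_bounded (h1.mul_left ((n : ℝ) ^ (3 / 4 : ℝ))).hasSum fun e : ℕ =>
    (norm_moebius_mul_le (x := 1 / (sqDivGcd e n : ℝ)) (by positivity) e).trans
      (one_div_sqDivGcd_le_rpow hn e)
  rw [tsum_mul_left, mul_comm, Real.norm_eq_abs] at this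
  exact this

lemma rpow_three_quarters_div_sq {n : ℕ} (hn : n ≠ 0) :
    (n : ℝ) ^ (3 / 4 : ℝ) / (n : ℝ) ^ 2 = 1 / (n : ℝ) ^ (5 / 4 : ℝ) := by
  have hn' : (0 : ℝ) < n := by exact_mod_cast Nat.pos_of_ne_zero hn
  have n2 : (n : ℝ) ^ 2 = (n : ℝ) ^ (3 / 4 : ℝ) * (n : ℝ) ^ (5 / 4 : ℝ) := by
    rw [← Real.rpow_add hn', ← Real.rpow_natCast]
    norm_num
  have h7 : (n : ℝ) ^ (3 / 4 : ℝ) ≠ 0 := by positivity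
  rw [n2]
  field_simp

lemma summable_pairWeight : Summable fun x : ℕ × ℕ => pairWeight x.1 x.2 := by
  have h1 : Summable fun e : ℕ => 1 / (e : ℝ) ^ (3 / 2 : ℝ) :=
    Real.summable_one_div_nat_rpow.2 (by norm_num)
  refine Summable.of_norm_bounded (h1.mul_of_nonneg summable_card_divisors_div_rpow
    (fun a => by positivity) (fun a => by positivity)) ?_
  rintro ⟨e, n⟩
  rcases eq_or_ne n 0 with rfl | hn
  · simp [pairWeight]
  simp only [pairWeight]
  rw [norm_mul]
  calc _ ≤ 1 / (sqDivGcd e n : ℝ) * ((n.divisors.card : ℝ) / (n : ℝ) ^ 2) := by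
        gcongr
        · exact norm_moebius_mul_le (by positivity) e
        · exact norm_moebius_mul_le (by positivity) n
    _ ≤ (n : ℝ) ^ (3 / 4 : ℝ) * (1 / (e : ℝ) ^ (3 / 2 : ℝ))
        * ((n.divisors.card : ℝ) / (n : ℝ) ^ 2) := by
        gcongr
        exact one_div_sqDivGcd_le_rpow hn e
    _ = _ := by
        rw [← rpow_three_quarters_div_sq hn]
        ring

lemma sum_divisorsAntidiagonal_pairWeight_prime {p : ℕ} (hp : p.Prime) :
    ∑' k : ℕ, ∑ x ∈ (p ^ k).divisorsAntidiagonal, pairWeight x.1 x.2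
      = 1 - 3 / (p : ℝ) ^ 2 + 2 / (p : ℝ) ^ 3 := by
  have hp0 : (p : ℝ) ≠ 0 := by exact_mod_cast hp.ne_zero
  have hbig : ∀ j, 2 ≤ j → ArithmeticFunction.moebius (p ^ j) = 0 := fun j hj => by
    rw [ArithmeticFunction.moebius_apply_prime_pow hp (by omega), if_neg (by omega)]
  have hsum : ∀ k, ∑ x ∈ (p ^ k).divisorsAntidiagonal, pairWeight x.1 x.2
      = ∑ j ∈ Finset.range (k + 1), pairWeight (p ^ j) (p ^ (k - j)) := fun k => by
    rw [Nat.sum_divisorsAntidiagonal, Nat.sum_divisors_prime_pow hp]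
    refine Finset.sum_congr rfl fun j hj => ?_
    rw [Nat.pow_div (by simpa [Nat.lt_succ_iff] using hj) hp.pos]
  have hmu : ArithmeticFunction.moebius p = -1 := ArithmeticFunction.moebius_apply_prime hp
  have hmu2 : ArithmeticFunction.moebius (p ^ 2) = 0 := hbig 2 le_rfl
  have hcard : p.divisors.card = 2 := by
    rw [hp.divisors, Finset.card_pair hp.one_lt.ne]
  have hgcd : Nat.gcd (p ^ 2) p = p := Nat.gcd_eq_right (dvd_pow_self p two_ne_zero)
  simp only [hsum]
  rw [tsum_eq_sum (s := Finset.range 3)]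
  · simp only [Finset.sum_range_succ, Finset.sum_range_zero, pairWeight, cast_sqDivGcd]
    simp [hmu, hmu2, hcard, hgcd]
    field_simp
    ring
  · intro k hk
    refine Finset.sum_eq_zero fun j hj => ?_
    simp only [Finset.mem_range, not_lt] at hk hj
    rcases le_or_gt 2 j with h | h
    · simp [pairWeight, hbig j h]
    · simp [pairWeight, hbig (k - j) (by omega)]

lemma hasProd_tsum_pairWeight :
    HasProd (fun p : Nat.Primes => 1 - 3 / ((p : ℕ) : ℝ) ^ 2 + 2 / ((p : ℕ) : ℝ) ^ 3)
      (∑' x : ℕ × ℕ, pairWeight x.1 x.2) := by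
  have h0 : ∀ x : ℕ × ℕ, x.1 * x.2 = 0 → pairWeight x.1 x.2 = 0 := by
    rintro ⟨a, b⟩ hab
    rcases Nat.mul_eq_zero.1 hab with rfl | rfl <;> simp [pairWeight]
  have hs := hasSum_sum_divisorsAntidiagonal h0 summable_pairWeight
  have hnorm : Summable fun m : ℕ =>
      ‖∑ x ∈ m.divisorsAntidiagonal, pairWeight x.1 x.2‖ := by
    refine Summable.of_nonneg_of_le (fun m => norm_nonneg _) (fun m => norm_sum_le _ _)
      (hasSum_sum_divisorsAntidiagonal (f := fun x => ‖pairWeight x.1 x.2‖) (fun x hx => ?_)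
        summable_pairWeight.norm).summable
    rw [h0 x hx, norm_zero]
  have := EulerProduct.eulerProduct_hasProd
    (f := fun m : ℕ => ∑ x ∈ m.divisorsAntidiagonal, pairWeight x.1 x.2)
    (by simp [pairWeight, sqDivGcd])
    (fun h => sum_divisorsAntidiagonal_mul_of_coprime pairWeight_mul_of_coprime h) hnorm
    (by simp)
  rw [hs.tsum_eq] at this
  rwa [funext fun p : Nat.Primes => sum_divisorsAntidiagonal_pairWeight_prime p.2] at this

lemma summable_moebius_mul_sqfDensity :
    Summable fun x : ℕ × ℕ => (ArithmeticFunction.moebius (x.1 * x.2) : ℝ)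
      * (1 / ((x.1 * x.2 : ℕ) : ℝ) ^ 2 * sqfDensity (x.1 * x.2)) := by
  obtain ⟨A, hA, hbound⟩ := exists_abs_sqfDensity_le
  have h1 : Summable fun a : ℕ => 1 / (a : ℝ) ^ (5 / 4 : ℝ) :=
    Real.summable_one_div_nat_rpow.2 (by norm_num)
  refine Summable.of_norm_bounded
    ((h1.mul_of_nonneg h1 (fun a => by positivity) (fun a => by positivity)).mul_left A) ?_
  rintro ⟨a, b⟩
  simp only
  rcases eq_or_ne (a * b) 0 with h | h
  · rw [h]
    simp only [ArithmeticFunction.map_zero, Int.cast_zero, zero_mul, norm_zero]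
    positivity
  rw [norm_mul, Real.norm_eq_abs, norm_mul, Real.norm_of_nonneg (by positivity), Real.norm_eq_abs]
  calc _ ≤ 1 * (1 / ((a * b : ℕ) : ℝ) ^ 2 * (A * ((a * b : ℕ) : ℝ) ^ (3 / 4 : ℝ))) := by
        gcongr
        · exact abs_moebius_cast_le_one _
        · exact hbound _ h
    _ = A * (((a * b : ℕ) : ℝ) ^ (3 / 4 : ℝ) / ((a * b : ℕ) : ℝ) ^ 2) := by ring
    _ = _ := by
        rw [rpow_three_quarters_div_sq h, Nat.cast_mul,
          Real.mul_rpow (by positivity) (by positivity), one_div_mul_one_div]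

lemma tsum_moebius_mul_sqfDensity :
    ∑' x : ℕ × ℕ, (ArithmeticFunction.moebius (x.1 * x.2) : ℝ)
      * (1 / ((x.1 * x.2 : ℕ) : ℝ) ^ 2 * sqfDensity (x.1 * x.2))
      = ∏' p : Nat.Primes, (1 - 3 / ((p : ℕ) : ℝ) ^ 2 + 2 / ((p : ℕ) : ℝ) ^ 3) := by
  have hp := summable_pairWeight.prod_symm
  rw [hasProd_tsum_pairWeight.tprod_eq, ← (hasSum_sum_divisorsAntidiagonal
    ?_ summable_moebius_mul_sqfDensity).tsum_eq, 
    ← (Equiv.prodComm ℕ ℕ).tsum_eq fun x => pairWeight x.1 x.2]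
  · refine Eq.trans (tsum_congr fun n => ?_) hp.tsum_prod.symm
    simp only [Prod.fst_swap, Prod.snd_swap, pairWeight]
    rw [tsum_mul_right, Finset.sum_congr rfl (g := fun _ => (ArithmeticFunction.moebius n : ℝ)
      * (1 / (n : ℝ) ^ 2 * sqfDensity n)), Finset.sum_const, nsmul_eq_mul,
      card_divisorsAntidiagonal, sqfDensity]
    · ring
    · intro x hx
      rw [(Nat.mem_divisorsAntidiagonal.1 hx).1]
  · rintro ⟨a, b⟩ hab
    simp only at hab
    simp [hab]

lemma moebius_pow_three (n : ℕ) :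
    (ArithmeticFunction.moebius n : ℝ) ^ 3 = ArithmeticFunction.moebius n := by
  rcases ArithmeticFunction.moebius_eq_or n with h | h | h <;> rw [h] <;> norm_num

lemma moebius_mul_eq_zero_of_not_coprime {a b : ℕ} (h : ¬ Nat.Coprime a b) :
    ArithmeticFunction.moebius (a * b) = 0 :=
  ArithmeticFunction.moebius_eq_zero_of_not_squarefree fun hs =>
    h (Nat.squarefree_mul_iff.1 hs).1

lemma moebius_mul_mul_moebius_mul {a b : ℕ} (g : ℕ) (hab : Nat.Coprime a b) :
    (ArithmeticFunction.moebius (g * a) : ℝ) * ArithmeticFunction.moebius (g * b)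
      = ArithmeticFunction.moebius (a * b) * (ArithmeticFunction.moebius (g * (a * b)) : ℝ) ^ 2 := by
  by_cases ha : Nat.Coprime g a
  · by_cases hb : Nat.Coprime g b
    · rw [ArithmeticFunction.isMultiplicative_moebius.map_mul_of_coprime ha,
        ArithmeticFunction.isMultiplicative_moebius.map_mul_of_coprime hb,
        ArithmeticFunction.isMultiplicative_moebius.map_mul_of_coprime (Nat.Coprime.mul_right ha hb),
        ArithmeticFunction.isMultiplicative_moebius.map_mul_of_coprime hab]
      push_cast
      linear_combination (-(ArithmeticFunction.moebius g : ℝ) ^ 2) *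
        (ArithmeticFunction.moebius a * moebius_pow_three b +
          (ArithmeticFunction.moebius b : ℝ) ^ 3 * moebius_pow_three a)
    · rw [moebius_mul_eq_zero_of_not_coprime hb, moebius_mul_eq_zero_of_not_coprime fun h =>
        hb h.coprime_mul_left_right]
      simp
  · rw [moebius_mul_eq_zero_of_not_coprime ha, moebius_mul_eq_zero_of_not_coprime fun h =>
      ha h.coprime_mul_right_right]
    simp

/-- The contribution of the pair `(g a, g b)` with `a`, `b` coprime. -/
noncomputable def diagTerm (H : ℝ) (x : (ℕ × ℕ) × ℕ) : ℝ :=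
  (ArithmeticFunction.moebius (x.1.1 * x.1.2) : ℝ) * (1 / ((x.1.1 * x.1.2 : ℕ) : ℝ) ^ 2) *
    ((ArithmeticFunction.moebius (x.2 * (x.1.1 * x.1.2)) : ℝ) ^ 2 * fractBump (H / (x.2 : ℝ) ^ 2))

lemma norm_diagTerm_le (H : ℝ) (a b g : ℕ) :
    ‖diagTerm H ((a, b), g)‖
      ≤ 1 / (a : ℝ) ^ 2 * (1 / (b : ℝ) ^ 2) * fractBump (H / (g : ℝ) ^ 2) := by
  have h0 := fractBump_nonneg (H / (g : ℝ) ^ 2)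
  have h1 := abs_moebius_cast_le_one (g * (a * b))
  rw [diagTerm, norm_mul]
  gcongr
  · refine (norm_moebius_mul_le (by positivity) _).trans_eq ?_
    rw [Nat.cast_mul, mul_pow, one_div_mul_one_div]
  · rw [Real.norm_of_nonneg (mul_nonneg (sq_nonneg _) h0)]
    exact mul_le_of_le_one_left h0 ((sq_le_one_iff_abs_le_one _).2 h1)

lemma summable_diagTerm {H : ℝ} (hH : 0 ≤ H) : Summable (diagTerm H) := by
  have h1 : Summable fun a : ℕ => 1 / (a : ℝ) ^ 2 := Real.summable_one_div_nat_pow.2 one_lt_two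
  have h2 := h1.mul_of_nonneg h1 (fun a => by positivity) (fun a => by positivity)
  refine Summable.of_norm_bounded (h2.mul_of_nonneg (summable_fractBump_div_sq hH)
    (fun a => by positivity) (fun g => fractBump_nonneg _)) ?_
  rintro ⟨⟨a, b⟩, g⟩
  exact norm_diagTerm_le H a b g

lemma exists_abs_tsum_diagTerm_sub_le :
    ∃ A : ℝ, 0 < A ∧ ∀ H : ℝ, 0 < H →
      |∑' x, diagTerm H x - sqfConst * √H| ≤ A * H ^ (2 / 5 : ℝ) := by
  obtain ⟨A, hA, hbound⟩ := exists_abs_tsum_moebius_sq_mul_fractBump_sub_le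
  have h1 : Summable fun a : ℕ => 1 / (a : ℝ) ^ (6 / 5 : ℝ) :=
    Real.summable_one_div_nat_rpow.2 (by norm_num)
  have h2 := h1.mul_of_nonneg h1 (fun a => by positivity) (fun a => by positivity)
  set W : ℝ := ∑' x : ℕ × ℕ, 1 / (x.1 : ℝ) ^ (6 / 5 : ℝ) * (1 / (x.2 : ℝ) ^ (6 / 5 : ℝ)) with hW
  have hW0 : 0 ≤ W := tsum_nonneg fun x => by positivity
  refine ⟨A * (W + 1), by positivity, fun H hH => ?_⟩
  have hs := summable_diagTerm hH.le
  set c : ℝ := (riemannZeta (3 / 2)).re / Real.pi with hc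
  have hmain := summable_moebius_mul_sqfDensity.mul_left (c * √H)
  have e1 : sqfConst * √H = ∑' x : ℕ × ℕ, c * √H *
      ((ArithmeticFunction.moebius (x.1 * x.2) : ℝ)
        * (1 / ((x.1 * x.2 : ℕ) : ℝ) ^ 2 * sqfDensity (x.1 * x.2))) := by
    rw [tsum_mul_left, tsum_moebius_mul_sqfDensity, sqfConst]
    ring
  have hle := tsum_of_norm_bounded (h2.mul_left (A * H ^ (2 / 5 : ℝ))).hasSum
    (f := fun x : ℕ × ℕ => ∑' g : ℕ, diagTerm H (x, g) - c * √H *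
      ((ArithmeticFunction.moebius (x.1 * x.2) : ℝ)
        * (1 / ((x.1 * x.2 : ℕ) : ℝ) ^ 2 * sqfDensity (x.1 * x.2)))) ?_
  · rw [hs.tsum_prod, e1, ← hs.prod.tsum_sub hmain]
    rw [tsum_mul_left, Real.norm_eq_abs] at hle
    refine hle.trans ?_
    rw [← hW]
    have : 0 ≤ A * H ^ (2 / 5 : ℝ) := by positivity
    nlinarith
  · rintro ⟨a, b⟩
    simp only [diagTerm]
    rw [tsum_mul_left]
    rcases eq_or_ne (a * b) 0 with h | h
    · rw [h]
      simp only [ArithmeticFunction.map_zero, Int.cast_zero, zero_mul, mul_zero, sub_zero,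
        norm_zero]
      positivity
    have h3 := hbound H hH (a * b) h
    have hab : (0 : ℝ) < ((a * b : ℕ) : ℝ) := by exact_mod_cast Nat.pos_of_ne_zero h
    have n2 : ((a * b : ℕ) : ℝ) ^ 2
        = ((a * b : ℕ) : ℝ) ^ (4 / 5 : ℝ) * ((a * b : ℕ) : ℝ) ^ (6 / 5 : ℝ) := by
      rw [← Real.rpow_add hab, ← Real.rpow_natCast]
      norm_num
    have n3 : 1 / (a : ℝ) ^ (6 / 5 : ℝ) * (1 / (b : ℝ) ^ (6 / 5 : ℝ))
        = 1 / ((a * b : ℕ) : ℝ) ^ (6 / 5 : ℝ) := by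
      rw [one_div_mul_one_div, Nat.cast_mul, Real.mul_rpow (by positivity) (by positivity)]
    rw [n3]
    generalize ∑' g : ℕ, (ArithmeticFunction.moebius (g * (a * b)) : ℝ) ^ 2
      * fractBump (H / (g : ℝ) ^ 2) = G at h3 ⊢
    generalize a * b = n at *
    rw [show (ArithmeticFunction.moebius n : ℝ) * (1 / (n : ℝ) ^ 2) * G - c * √H *
        ((ArithmeticFunction.moebius n : ℝ) * (1 / (n : ℝ) ^ 2 * sqfDensity n))
      = (ArithmeticFunction.moebius n : ℝ) * (1 / (n : ℝ) ^ 2) * (G - c * √H * sqfDensity n) by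
        ring, norm_mul]
    calc _ ≤ 1 / (n : ℝ) ^ 2 * (A * H ^ (2 / 5 : ℝ) * (n : ℝ) ^ (4 / 5 : ℝ)) := by
          gcongr
          · exact norm_moebius_mul_le (by positivity) n
          · exact h3
      _ = _ := by
          have : (n : ℝ) ^ (4 / 5 : ℝ) ≠ 0 := by positivity
          rw [n2]
          field_simp

/-- The triples `((a, b), g)` with `g a ≤ D` and `g b ≤ D`. -/
def diagBox (D : ℕ) : Finset ((ℕ × ℕ) × ℕ) :=
  ((Finset.Icc 1 D ×ˢ Finset.Icc 1 D) ×ˢ Finset.Icc 1 D).filter fun x =>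
    x.2 * x.1.1 ≤ D ∧ x.2 * x.1.2 ≤ D

lemma mem_diagBox {D a b g : ℕ} (ha : 0 < a) (hb : 0 < b) (hg : 0 < g) :
    ((a, b), g) ∈ diagBox D ↔ g * a ≤ D ∧ g * b ≤ D := by
  simp only [diagBox, Finset.mem_filter, Finset.mem_product, Finset.mem_Icc, and_iff_right_iff_imp]
  rintro ⟨h1, h2⟩
  have := Nat.le_mul_of_pos_left a hg
  have := Nat.le_mul_of_pos_left b hg
  have := Nat.le_mul_of_pos_right g ha
  omega

lemma tsum_sinc_sq {H G : ℝ} (hH : 0 < H) (hG : 0 < G) :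
    2 * H ^ 2 * ∑' lam : ℕ+, sinc (H * ((lam : ℕ) : ℝ) / G) ^ 2 = G ^ 2 * fractBump (H / G) := by
  have h1 := hasSum_sin_sq_div_sq (H / G)
  have h2 : ∑' lam : ℕ+, Real.sin (Real.pi * ((lam : ℕ) : ℝ) * (H / G)) ^ 2 / ((lam : ℕ) : ℝ) ^ 2
      = Real.pi ^ 2 / 2 * fractBump (H / G) := by
    rw [tsum_pnat_eq_tsum_succ
      (f := fun k : ℕ => Real.sin (Real.pi * (k : ℝ) * (H / G)) ^ 2 / (k : ℝ) ^ 2), ← h1.tsum_eq,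
      h1.summable.tsum_eq_zero_add]
    simp
  have h3 : ∀ lam : ℕ+, sinc (H * ((lam : ℕ) : ℝ) / G) ^ 2
      = (G / (Real.pi * H)) ^ 2 *
        (Real.sin (Real.pi * ((lam : ℕ) : ℝ) * (H / G)) ^ 2 / ((lam : ℕ) : ℝ) ^ 2) := by
    intro lam
    have hl : (0 : ℝ) < ((lam : ℕ) : ℝ) := by exact_mod_cast lam.pos
    rw [sinc, if_neg (by positivity),
      show Real.pi * (H * ((lam : ℕ) : ℝ) / G) = Real.pi * ((lam : ℕ) : ℝ) * (H / G) by ring]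
    have := Real.pi_pos
    field_simp
  rw [tsum_congr h3, tsum_mul_left, h2]
  have := Real.pi_pos
  field_simp

lemma sum_sinc_eq_sum_diagTerm {H : ℝ} (hH : 0 < H) (D : ℕ) :
    2 * H ^ 2 *
      (∑ d₁ ∈ Finset.Icc 1 D, ∑ d₂ ∈ Finset.Icc 1 D,
        (ArithmeticFunction.moebius d₁ : ℝ) * (ArithmeticFunction.moebius d₂ : ℝ)
            / ((d₁ : ℝ) ^ 2 * (d₂ : ℝ) ^ 2) *
          ∑' lam : ℕ+, sinc (H * ((lam : ℕ) : ℝ) / (Nat.gcd (d₁ ^ 2) (d₂ ^ 2) : ℝ)) ^ 2)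
      = ∑ x ∈ diagBox D, diagTerm H x := by
  rw [← Finset.sum_filter_of_ne (p := fun x : (ℕ × ℕ) × ℕ => Nat.Coprime x.1.1 x.1.2) (s := diagBox D),
    ← Finset.sum_product', Finset.mul_sum]
  · refine Finset.sum_nbij' (fun d => ((d.1 / Nat.gcd d.1 d.2, d.2 / Nat.gcd d.1 d.2),
      Nat.gcd d.1 d.2)) (fun x => (x.2 * x.1.1, x.2 * x.1.2)) ?_ ?_ ?_ ?_ ?_
    · rintro ⟨d₁, d₂⟩ hd
      simp only [Finset.mem_product, Finset.mem_Icc] at hd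
      have hg := Nat.gcd_pos_of_pos_left d₂ (show 0 < d₁ by omega)
      have h1 := Nat.div_pos (Nat.gcd_le_left d₂ (show 0 < d₁ by omega)) hg
      have h2 := Nat.div_pos (Nat.gcd_le_right d₁ (show 0 < d₂ by omega)) hg
      refine Finset.mem_filter.2 ⟨(mem_diagBox h1 h2 hg).2 ?_, Nat.coprime_div_gcd_div_gcd hg⟩
      rw [Nat.mul_div_cancel' (Nat.gcd_dvd_left _ _), Nat.mul_div_cancel' (Nat.gcd_dvd_right _ _)]
      exact ⟨hd.1.2, hd.2.2⟩
    · rintro ⟨⟨a, b⟩, g⟩ hx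
      simp only [diagBox, Finset.mem_filter, Finset.mem_product, Finset.mem_Icc] at hx ⊢
      have h1 : 0 < g * a := Nat.mul_pos (by omega) (by omega)
      have h2 : 0 < g * b := Nat.mul_pos (by omega) (by omega)
      omega
    · rintro ⟨d₁, d₂⟩ -
      simp only
      rw [Nat.mul_div_cancel' (Nat.gcd_dvd_left _ _), Nat.mul_div_cancel' (Nat.gcd_dvd_right _ _)]
    · rintro ⟨⟨a, b⟩, g⟩ hx
      simp only [diagBox, Finset.mem_filter, Finset.mem_product, Finset.mem_Icc] at hx
      have hg : 0 < g := by omega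
      simp only [Nat.gcd_mul_left, hx.2.gcd_eq_one, mul_one, Nat.mul_div_cancel_left _ hg]
    · rintro ⟨d₁, d₂⟩ hd
      simp only [Finset.mem_product, Finset.mem_Icc] at hd
      simp only [diagTerm]
      obtain ⟨g, a, b, hg, hab, h1, h2⟩ := Nat.exists_coprime'
        (Nat.gcd_pos_of_pos_left d₂ (show 0 < d₁ by omega))
      subst h1 h2
      have ha : 0 < a := Nat.pos_of_mul_pos_right (show 0 < a * g by omega)
      have hb : 0 < b := Nat.pos_of_mul_pos_right (show 0 < b * g by omega)
      have hgcd : Nat.gcd (a * g) (b * g) = g := by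
        rw [Nat.gcd_mul_right, hab.gcd_eq_one, one_mul]
      have hgcd2 : Nat.gcd ((a * g) ^ 2) ((b * g) ^ 2) = g ^ 2 := by
        rw [mul_pow, mul_pow, Nat.gcd_mul_right, (Nat.Coprime.pow 2 2 hab).gcd_eq_one, one_mul]
      have ha' : (0 : ℝ) < a := by exact_mod_cast ha
      have hb' : (0 : ℝ) < b := by exact_mod_cast hb
      have hg' : (0 : ℝ) < g := by exact_mod_cast hg
      have hs := tsum_sinc_sq (G := ((g ^ 2 : ℕ) : ℝ)) hH (by positivity)
      have hm := moebius_mul_mul_moebius_mul g hab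
      rw [hgcd, hgcd2, Nat.mul_div_cancel _ hg, Nat.mul_div_cancel _ hg, mul_left_comm, hs,
        mul_comm a g, mul_comm b g, hm]
      push_cast
      field_simp
  · rintro ⟨⟨a, b⟩, g⟩ - hne
    by_contra h
    refine hne ?_
    simp only [diagTerm]
    rw [moebius_mul_eq_zero_of_not_coprime h]
    simp

lemma one_le_rpow_mul_of_notMem_diagBox {z : ℝ} (hz : 0 < z) {a b g : ℕ} (ha : 0 < a) (hb : 0 < b)
    (hg : 0 < g) (h : ((a, b), g) ∉ diagBox ⌊√z⌋₊) :
    1 ≤ ((g : ℝ) * a * b) ^ (1 / 2 : ℝ) * z ^ (-(1 / 4) : ℝ) := by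
  rw [mem_diagBox ha hb hg, not_and_or, not_le, not_le, Nat.floor_lt (Real.sqrt_nonneg z),
    Nat.floor_lt (Real.sqrt_nonneg z)] at h
  have ha' : (1 : ℝ) ≤ a := by exact_mod_cast ha
  have hb' : (1 : ℝ) ≤ b := by exact_mod_cast hb
  have hg' : (1 : ℝ) ≤ g := by exact_mod_cast hg
  have hle : √z ≤ (g : ℝ) * a * b := by
    push_cast at h
    rcases h with h | h
    · exact h.le.trans (le_mul_of_one_le_right (by positivity) hb')
    · refine h.le.trans ?_
      rw [mul_assoc, mul_left_comm]
      exact le_mul_of_one_le_left (by positivity) ha'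
  calc (1 : ℝ) = (√z) ^ (1 / 2 : ℝ) * z ^ (-(1 / 4) : ℝ) := by
        rw [Real.sqrt_eq_rpow, ← Real.rpow_mul hz.le, ← Real.rpow_add hz]
        norm_num
    _ ≤ _ := by gcongr

lemma exists_abs_tsum_diagTerm_sub_sum_le {ε : ℝ} (h0 : 0 < ε) (h1 : ε ≤ 1) :
    ∃ A : ℝ, 0 < A ∧ ∀ H z : ℝ, 0 < H → 0 < z →
      |∑' x, diagTerm H x - ∑ x ∈ diagBox ⌊√z⌋₊, diagTerm H x|
        ≤ A * (H ^ (3 / 4 + ε / 8) * z ^ (-(1 / 4) : ℝ)) := by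
  have s1 : Summable fun a : ℕ => 1 / (a : ℝ) ^ (3 / 2 : ℝ) :=
    Real.summable_one_div_nat_rpow.2 (by norm_num)
  have s2 : Summable fun g : ℕ => 1 / (g : ℝ) ^ (1 + ε / 4) :=
    Real.summable_one_div_nat_rpow.2 (by linarith)
  have s3 := (s1.mul_of_nonneg s1 (fun a => by positivity) (fun a => by positivity)).mul_of_nonneg
    s2 (fun a => by positivity) (fun a => by positivity)
  set W : ℝ := ∑' x : (ℕ × ℕ) × ℕ, 1 / (x.1.1 : ℝ) ^ (3 / 2 : ℝ) * (1 / (x.1.2 : ℝ) ^ (3 / 2 : ℝ))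
    * (1 / (x.2 : ℝ) ^ (1 + ε / 4)) with hW
  have hW0 : 0 ≤ W := tsum_nonneg fun x => by positivity
  refine ⟨W + 1, by positivity, fun H z hH hz => ?_⟩
  set R : ℝ := H ^ (3 / 4 + ε / 8) * z ^ (-(1 / 4) : ℝ) with hR
  have hR0 : 0 ≤ R := by positivity
  have hs := summable_diagTerm hH.le
  have hle := tsum_of_norm_bounded (s3.mul_left R).hasSum
    (f := fun x => diagTerm H x - Set.indicator (diagBox ⌊√z⌋₊) (diagTerm H) x) ?_
  · rw [hs.tsum_sub (hs.indicator _), ← sum_eq_tsum_indicator, tsum_mul_left,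
      Real.norm_eq_abs] at hle
    refine hle.trans ?_
    rw [← hW]
    nlinarith
  · rintro ⟨⟨a, b⟩, g⟩
    by_cases hx : ((a, b), g) ∈ diagBox ⌊√z⌋₊
    · rw [Set.indicator_of_mem (by exact hx), sub_self, norm_zero]
      positivity
    rw [Set.indicator_of_notMem (by exact hx), sub_zero]
    rcases Nat.eq_zero_or_pos a with rfl | ha
    · simp [diagTerm, Real.zero_rpow]
    rcases Nat.eq_zero_or_pos b with rfl | hb
    · simp [diagTerm, Real.zero_rpow]
    rcases Nat.eq_zero_or_pos g with rfl | hg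
    · simp only [diagTerm, zero_mul, ArithmeticFunction.map_zero, Int.cast_zero, ne_eq,
        OfNat.ofNat_ne_zero, not_false_eq_true, zero_pow, mul_zero, norm_zero]
      positivity
    have ha' : (0 : ℝ) < a := by exact_mod_cast ha
    have hb' : (0 : ℝ) < b := by exact_mod_cast hb
    have hg' : (0 : ℝ) < g := by exact_mod_cast hg
    have hone := one_le_rpow_mul_of_notMem_diagBox hz ha hb hg hx
    have hphi := fractBump_le_rpow (x := H / (g : ℝ) ^ 2) (t := 3 / 4 + ε / 8) (by positivity)
      (by positivity) (by linarith)
    have hsplit : ∀ {y : ℝ}, 0 < y → 1 / y ^ 2 * y ^ (1 / 2 : ℝ) = 1 / y ^ (3 / 2 : ℝ) := by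
      intro y hy
      have : y ^ 2 = y ^ (1 / 2 : ℝ) * y ^ (3 / 2 : ℝ) := by
        rw [← Real.rpow_add hy, ← Real.rpow_natCast]
        norm_num
      have : y ^ (1 / 2 : ℝ) ≠ 0 := by positivity
      simp only [*]
      field_simp
    have hgs : (H / (g : ℝ) ^ 2) ^ (3 / 4 + ε / 8) * (g : ℝ) ^ (1 / 2 : ℝ)
        = H ^ (3 / 4 + ε / 8) * (1 / (g : ℝ) ^ (1 + ε / 4)) := by
      rw [Real.div_rpow hH.le (by positivity), ← Real.rpow_natCast, ← Real.rpow_mul hg'.le,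
        div_mul_eq_mul_div, mul_div_assoc, ← Real.rpow_sub hg', one_div ((g : ℝ) ^ _), ← Real.rpow_neg hg'.le]
      congr 2
      push_cast
      ring
    calc ‖diagTerm H ((a, b), g)‖
        ≤ 1 / (a : ℝ) ^ 2 * (1 / (b : ℝ) ^ 2) * (H / (g : ℝ) ^ 2) ^ (3 / 4 + ε / 8) * 1 := by
          rw [mul_one]
          exact (norm_diagTerm_le H a b g).trans (by gcongr)
      _ ≤ 1 / (a : ℝ) ^ 2 * (1 / (b : ℝ) ^ 2) * (H / (g : ℝ) ^ 2) ^ (3 / 4 + ε / 8) *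
          (((g : ℝ) * a * b) ^ (1 / 2 : ℝ) * z ^ (-(1 / 4) : ℝ)) := by gcongr
      _ = (1 / (a : ℝ) ^ 2 * (a : ℝ) ^ (1 / 2 : ℝ)) * (1 / (b : ℝ) ^ 2 * (b : ℝ) ^ (1 / 2 : ℝ)) *
          ((H / (g : ℝ) ^ 2) ^ (3 / 4 + ε / 8) * (g : ℝ) ^ (1 / 2 : ℝ)) * z ^ (-(1 / 4) : ℝ) := by
          rw [Real.mul_rpow (by positivity) hb'.le, Real.mul_rpow hg'.le ha'.le]
          ring
      _ = _ := by
          rw [hsplit ha', hsplit hb', hgs, hR]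
          ring

theorem sinc_diagonal_asymptotic :
    ∀ ε : ℝ, ε ∈ Set.Ioo (0 : ℝ) (1 / 100) →
      ∃ K : ℝ, 0 < K ∧
        ∀ H z : ℝ, 1 ≤ H → H ^ (1 + ε) ≤ z →
          |2 * H ^ 2 *
              (∑ d₁ ∈ Finset.Icc 1 ⌊Real.sqrt z⌋₊, ∑ d₂ ∈ Finset.Icc 1 ⌊Real.sqrt z⌋₊,
                (ArithmeticFunction.moebius d₁ : ℝ) * (ArithmeticFunction.moebius d₂ : ℝ)
                    / ((d₁ : ℝ) ^ 2 * (d₂ : ℝ) ^ 2) *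
                  ∑' lam : ℕ+,
                    sinc (H * ((lam : ℕ) : ℝ) / (Nat.gcd (d₁ ^ 2) (d₂ ^ 2) : ℝ)) ^ 2)
            - sqfConst * H ^ ((1 : ℝ) / 2)|
          ≤ K * H ^ ((1 : ℝ) / 2 - ε / 8) := by
  rintro ε ⟨h0, h1⟩
  obtain ⟨A, hA, hmain⟩ := exists_abs_tsum_diagTerm_sub_le
  obtain ⟨B, hB, htail⟩ := exists_abs_tsum_diagTerm_sub_sum_le h0 (by linarith)
  refine ⟨A + B, by positivity, fun H z hH hz => ?_⟩
  have hH0 : 0 < H := by linarith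
  have hpow : 0 < H ^ (1 + ε) := by positivity
  have hz0 : 0 < z := hpow.trans_le hz
  rw [sum_sinc_eq_sum_diagTerm hH0, ← Real.sqrt_eq_rpow]
  have e1 := hmain H hH0
  have e2 := htail H z hH0 hz0
  have e3 : H ^ (2 / 5 : ℝ) ≤ H ^ ((1 : ℝ) / 2 - ε / 8) :=
    Real.rpow_le_rpow_of_exponent_le hH (by linarith)
  have e4 : H ^ (3 / 4 + ε / 8) * z ^ (-(1 / 4) : ℝ) ≤ H ^ ((1 : ℝ) / 2 - ε / 8) := by
    calc _ ≤ H ^ (3 / 4 + ε / 8) * (H ^ (1 + ε)) ^ (-(1 / 4) : ℝ) := by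
          gcongr ?_ * ?_
          exact Real.rpow_le_rpow_of_nonpos hpow hz (by norm_num)
      _ = _ := by
          rw [← Real.rpow_mul hH0.le, ← Real.rpow_add hH0]
          congr 1
          ring
  have e5 := mul_le_mul_of_nonneg_left e3 hA.le
  have e6 := mul_le_mul_of_nonneg_left e4 hB.le
  rw [abs_le] at e1 e2 ⊢
  constructor <;> linarith [e1.1, e1.2, e2.1, e2.2]
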